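/- Let Φ ∈ ℝ \ ℤ and let V ∈ L^∞(ℝ²) satisfy V(x) = |x|^{−2} (ln|x|)^{−1} (1 + o(1)) as |x| → ∞, i.e. |x|² (ln|x|) V(x) → 1 as |x| → ∞. For λ > 0 let N_Φ(λV) ∈ ℕ ∪ {∞} be the supremum of dim M over all finite-dimensional complex subspaces M of C_c^∞(ℝ²\{0}; ℂ) that are (λV)-negative for D_Φ. Then lim_{λ→∞} (λ ln λ)^{−1} N_Φ(λV) = 1/2. (Strong-coupling eigenvalue asymptotics in the borderline case p = 1.) -/

import Mathlib

open MeasureTheory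

/-- The square of the Euclidean norm on `ℝ²`. -/
noncomputable def sqnorm (x : ℝ × ℝ) : ℝ := x.1 ^ 2 + x.2 ^ 2

/-- Smooth compactly supported functions on `ℝ²` vanishing in a neighbourhood of `0`. -/
def IsTestFun (u : ℝ × ℝ → ℂ) : Prop :=
  ContDiff ℝ (⊤ : ℕ∞) u ∧ HasCompactSupport u ∧ ∀ᶠ x in nhds (0 : ℝ × ℝ), u x = 0

/-- The magnetic energy `∫ |D_Φ u|²` for the Aharonov–Bohm vector potential
`A(x) = |x|⁻² (x₂, -x₁)`, where `D_Φ u = -i∇u + Φ A u`. -/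
noncomputable def magEnergy (Φ : ℝ) (u : ℝ × ℝ → ℂ) : ℝ :=
  ∫ x : ℝ × ℝ,
    (‖-Complex.I * fderiv ℝ u x (1, 0) + ((Φ * (x.2 / sqnorm x) : ℝ) : ℂ) * u x‖ ^ 2 +
     ‖-Complex.I * fderiv ℝ u x (0, 1) + ((Φ * (-x.1 / sqnorm x) : ℝ) : ℂ) * u x‖ ^ 2)

/-- A subspace `M` of test functions is `V`-negative for `D_Φ` if
every nonzero `u ∈ M` satisfies `∫ |D_Φ u|² < ∫ V |u|²`. -/
def IsVNegative (Φ : ℝ) (V : ℝ × ℝ → ℝ) (M : Submodule ℂ (ℝ × ℝ → ℂ)) : Prop :=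
  (∀ u ∈ M, IsTestFun u) ∧
  ∀ u ∈ M, u ≠ 0 → magEnergy Φ u < ∫ x : ℝ × ℝ, V x * ‖u x‖ ^ 2

open scoped ENNReal

/-- The number `N(D_Φ² - W)` of negative eigenvalues, expressed via the variational
principle as the supremum of `dim M` over finite-dimensional `W`-negative subspaces of
test functions. -/
noncomputable def negEigCount (Φ : ℝ) (W : ℝ × ℝ → ℝ) : ℝ≥0∞ :=
  ⨆ (M : Submodule ℂ (ℝ × ℝ → ℂ)) (_ : FiniteDimensional ℂ M ∧ IsVNegative Φ W M),
    (Module.finrank ℂ M : ℝ≥0∞)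

section StrongCoupling

open Real Set Filter Topology

/-- Sharp Dirichlet inequality on an interval, by completing the square with the Riccati
solution `κ tan (κ (t - c))`. -/
lemma dirichlet_interval_nonneg {f f' : ℝ → ℂ} {a b κ : ℝ} (hab : a ≤ b)
    (hf : ∀ t, HasDerivAt f (f' t) t) (hf' : Continuous f') (fa : f a = 0) (fb : f b = 0)
    (hκ : 0 ≤ κ) (hκb : κ * (b - a) < π) :
    0 ≤ ∫ t in a..b, (‖f' t‖ ^ 2 - κ ^ 2 * ‖f t‖ ^ 2) := by
  have hfc : Continuous f := continuous_iff_continuousAt.2 fun t => (hf t).continuousAt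
  set c := (a + b) / 2 with hc
  have hcos : ∀ t ∈ Icc a b, cos (κ * (t - c)) ≠ 0 := by
    intro t ht
    have h1 : κ * (t - c) ≤ κ * ((b - a) / 2) :=
      mul_le_mul_of_nonneg_left (by rw [hc]; linarith [ht.2]) hκ
    have h2 : κ * (-((b - a) / 2)) ≤ κ * (t - c) :=
      mul_le_mul_of_nonneg_left (by rw [hc]; linarith [ht.1]) hκ
    exact (cos_pos_of_mem_Ioo ⟨by linarith, by linarith⟩).ne'
  set G' : ℝ → ℝ := fun t => κ * (1 / cos (κ * (t - c)) ^ 2 * κ) * ‖f t‖ ^ 2 +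
    κ * tan (κ * (t - c)) * (2 * inner ℝ (f t) (f' t)) with hG'
  have hder : ∀ t ∈ uIcc a b,
      HasDerivAt (fun t => κ * tan (κ * (t - c)) * ‖f t‖ ^ 2) (G' t) t := by
    intro t ht
    rw [uIcc_of_le hab] at ht
    have h1 : HasDerivAt (fun t => κ * (t - c)) κ t := by
      simpa using ((hasDerivAt_id t).sub_const c).const_mul κ
    exact (((hasDerivAt_tan (hcos t ht)).comp t h1).const_mul κ).mul (hf t).norm_sq
  have hGc : ContinuousOn G' (uIcc a b) := by
    rw [uIcc_of_le hab]
    have hlin : Continuous fun t => κ * (t - c) := by fun_prop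
    refine ContinuousOn.add (ContinuousOn.mul (ContinuousOn.mul continuousOn_const
      (ContinuousOn.mul (ContinuousOn.div continuousOn_const (by fun_prop) ?_)
        continuousOn_const)) (by fun_prop)) (ContinuousOn.mul (ContinuousOn.mul
        continuousOn_const ?_) ?_)
    · intro t ht; exact pow_ne_zero _ (hcos t ht)
    · intro t ht
      exact ((continuousAt_tan.2 (hcos t ht)).comp (f := fun t => κ * (t - c))
        hlin.continuousAt).continuousWithinAt
    · exact (continuous_const.mul (hfc.inner hf')).continuousOn
  have hint := intervalIntegral.integral_eq_sub_of_hasDerivAt hder hGc.intervalIntegrable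
  rw [fa, fb] at hint
  simp only [norm_zero, ne_eq, OfNat.ofNat_ne_zero, not_false_eq_true, zero_pow, mul_zero,
    sub_zero] at hint
  have hP : IntervalIntegrable (fun t => ‖f' t‖ ^ 2 - κ ^ 2 * ‖f t‖ ^ 2) volume a b :=
    Continuous.intervalIntegrable (by fun_prop) _ _
  have hsum := intervalIntegral.integral_add hP hGc.intervalIntegrable
  rw [hint, add_zero] at hsum
  rw [← hsum]
  refine intervalIntegral.integral_nonneg hab fun t ht => ?_
  have hsq : 1 / cos (κ * (t - c)) ^ 2 = 1 + tan (κ * (t - c)) ^ 2 := by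
    have := hcos t ht
    rw [tan_eq_sin_div_cos]
    field_simp
    linarith [sin_sq_add_cos_sq (κ * (t - c))]
  have h0 : 0 ≤ ‖f' t + (κ * tan (κ * (t - c))) • f t‖ ^ 2 := by positivity
  rw [norm_add_sq_real, inner_smul_right, norm_smul, mul_pow, Real.norm_eq_abs, sq_abs,
    real_inner_comm] at h0
  simp only [hG', hsq]
  linarith

/-- Subdivided version: `f` vanishes at the `m + 1` equidistant points of `[a, a + 1]`. -/
lemma dirichlet_unit_nonneg {f f' : ℝ → ℂ} {a κ : ℝ} {m : ℕ} (hm : 0 < m)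
    (hf : ∀ t, HasDerivAt f (f' t) t) (hf' : Continuous f')
    (hz : ∀ i ≤ m, f (a + i / m) = 0) (hκ : 0 ≤ κ) (hκm : κ < π * m) :
    0 ≤ ∫ t in a..(a + 1), (‖f' t‖ ^ 2 - κ ^ 2 * ‖f t‖ ^ 2) := by
  have hfc : Continuous f := continuous_iff_continuousAt.2 fun t => (hf t).continuousAt
  have hm' : (0 : ℝ) < m := by exact_mod_cast hm
  have h := intervalIntegral.sum_integral_adjacent_intervals (μ := volume)
    (f := fun t => ‖f' t‖ ^ 2 - κ ^ 2 * ‖f t‖ ^ 2) (a := fun i : ℕ => a + i / m) (n := m)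
    (fun k _ => Continuous.intervalIntegrable (by fun_prop) _ _)
  simp only [Nat.cast_zero, zero_div, add_zero, div_self hm'.ne'] at h
  rw [← h]
  refine Finset.sum_nonneg fun i hi => ?_
  have hi := Finset.mem_range.1 hi
  have hlen : (a + ((i + 1 : ℕ) : ℝ) / m) - (a + i / m) = 1 / m := by push_cast; ring
  refine dirichlet_interval_nonneg ?_ hf hf' (hz i hi.le) (hz (i + 1) hi) hκ ?_
  · have : (0 : ℝ) < 1 / m := by positivity
    linarith
  · rw [hlen, mul_one_div, div_lt_iff₀ hm']; exact hκm

/-- Near-optimal trial functions for the Dirichlet problem on the unit interval. -/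
lemma exists_bump_unit {η : ℝ} (hη : 1 < η) : ∃ g : ℝ → ℝ, ContDiff ℝ (⊤ : ℕ∞) g ∧
    (∃ ρ > 0, ∀ t, t ≤ ρ ∨ 1 - ρ ≤ t → g t = 0) ∧
    ∫ t in (0 : ℝ)..1, deriv g t ^ 2 < (π * η) ^ 2 * ∫ t in (0 : ℝ)..1, g t ^ 2 := by
  obtain ⟨C, hC⟩ := (isCompact_Icc (a := (-1 : ℝ)) (b := 1)).exists_bound_of_continuousOn
    (f := deriv smoothTransition)
    ((smoothTransition.contDiff (n := 1)).continuous_deriv le_rfl).continuousOn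
  have hC0 : 0 ≤ C := (norm_nonneg _).trans (hC 0 (by norm_num))
  set M := 2 * π * C + π with hM
  obtain ⟨δ, hδ0, hδ4, hδ⟩ : ∃ δ : ℝ, 0 < δ ∧ δ < 1 / 4 ∧
      4 * δ * (M ^ 2 + π ^ 2 * η ^ 2) < π ^ 2 * (η ^ 2 - 1) / 2 := by
    have hpos : 0 < π ^ 2 * (η ^ 2 - 1) / 2 := by
      have : 0 < η ^ 2 - 1 := by nlinarith
      positivity
    have hA : 0 < 4 * (M ^ 2 + π ^ 2 * η ^ 2) := by positivity
    refine ⟨min (1 / 8) (π ^ 2 * (η ^ 2 - 1) / 2 / (4 * (M ^ 2 + π ^ 2 * η ^ 2)) / 2), ?_, ?_, ?_⟩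
    · positivity
    · exact (min_le_left _ _).trans_lt (by norm_num)
    · have h1 := min_le_right (1 / 8)
        (π ^ 2 * (η ^ 2 - 1) / 2 / (4 * (M ^ 2 + π ^ 2 * η ^ 2)) / 2)
      have h2 : π ^ 2 * (η ^ 2 - 1) / 2 / (4 * (M ^ 2 + π ^ 2 * η ^ 2)) / 2 <
          π ^ 2 * (η ^ 2 - 1) / 2 / (4 * (M ^ 2 + π ^ 2 * η ^ 2)) := half_lt_self (by positivity)
      have h3 := (lt_div_iff₀ hA).1 (h1.trans_lt h2)
      linarith
  set g : ℝ → ℝ := fun t =>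
    smoothTransition (t / δ - 1) * smoothTransition ((1 - t) / δ - 1) * sin (π * t) with hg
  have hχ : ContDiff ℝ (⊤ : ℕ∞) smoothTransition := smoothTransition.contDiff
  have hgs : ContDiff ℝ (⊤ : ℕ∞) g :=
    ((hχ.comp (by fun_prop)).mul (hχ.comp (by fun_prop))).mul (by fun_prop)
  have hsymm : ∀ t, g (1 - t) = g t := by
    intro t
    simp only [hg, sub_sub_cancel]
    rw [mul_sub, mul_one, sin_pi_sub, mul_comm (smoothTransition ((1 - t) / δ - 1))]
  have hdsymm : ∀ t, deriv g (1 - t) ^ 2 = deriv g t ^ 2 := by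
    intro t
    have h := deriv_comp_const_sub (f := g) 1 t
    rw [show (fun x => g (1 - x)) = g from funext hsymm] at h
    rw [h, neg_sq]
  have hgd : Continuous (deriv g) := hgs.continuous_deriv (by simp)
  have hone : ∀ x : ℝ, 2 * δ ≤ x → smoothTransition (x / δ - 1) = 1 := by
    intro x hx
    refine smoothTransition.one_of_one_le ?_
    have : 2 ≤ x / δ := by rw [le_div_iff₀ hδ0]; exact hx
    linarith
  have hmid : ∀ t ∈ Ioo (2 * δ) (1 - 2 * δ), deriv g t = cos (π * t) * π := by
    intro t ht
    have he : g =ᶠ[𝓝 t] fun t => sin (π * t) := by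
      filter_upwards [isOpen_Ioo.mem_nhds ht] with x hx
      simp only [hg]
      rw [hone x hx.1.le, hone (1 - x) (by linarith [hx.2]), one_mul, one_mul]
    rw [he.deriv_eq]
    have h1 : HasDerivAt (fun t => π * t) π t := by simpa using (hasDerivAt_id t).const_mul π
    exact h1.sin.deriv
  have hedge : ∀ t ∈ Icc 0 (2 * δ), deriv g t ^ 2 ≤ M ^ 2 := by
    intro t ht
    have he : g =ᶠ[𝓝 t] fun t => smoothTransition (t / δ - 1) * sin (π * t) := by
      filter_upwards [Iio_mem_nhds (show t < 1 - 2 * δ by linarith [ht.2])] with x hx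
      simp only [hg]
      rw [hone (1 - x) (by linarith [mem_Iio.1 hx]), mul_one]
    have h1 : HasDerivAt (fun t => π * t) π t := by simpa using (hasDerivAt_id t).const_mul π
    have h2 : HasDerivAt (fun t => t / δ - 1) (1 / δ) t :=
      ((hasDerivAt_id t).div_const δ).sub_const 1
    have h3 : HasDerivAt smoothTransition (deriv smoothTransition (t / δ - 1)) (t / δ - 1) :=
      ((smoothTransition.contDiff (n := 1)).differentiable one_ne_zero _).hasDerivAt
    have h4 := ((h3.comp t h2).mul h1.sin).deriv
    have hmem : t / δ - 1 ∈ Icc (-1 : ℝ) 1 := by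
      have : t / δ ≤ 2 := by rw [div_le_iff₀ hδ0]; exact ht.2
      have : 0 ≤ t / δ := div_nonneg ht.1 hδ0.le
      constructor <;> linarith
    have hb := hC _ hmem
    rw [Real.norm_eq_abs] at hb
    rw [he.deriv_eq, show (fun t => smoothTransition (t / δ - 1) * sin (π * t)) =
      (smoothTransition ∘ fun t => t / δ - 1) * fun t => sin (π * t) from rfl, h4]
    rw [sq_le_sq, abs_of_nonneg (show 0 ≤ M by positivity)]
    have hs : |sin (π * t)| ≤ π * (2 * δ) := by
      rcases le_or_gt (π * t) 0 with h | h
      · have : π * t = 0 := le_antisymm h (mul_nonneg pi_pos.le ht.1)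
        rw [this]; simp; positivity
      · refine abs_sin_le_abs.trans ?_
        rw [abs_of_pos h]
        exact mul_le_mul_of_nonneg_left ht.2 pi_pos.le
    refine (abs_add_le _ _).trans ?_
    rw [hM]
    refine add_le_add ?_ ?_
    · rw [abs_mul, abs_mul, abs_of_pos (show 0 < 1 / δ by positivity)]
      calc |deriv smoothTransition (t / δ - 1)| * (1 / δ) * |sin (π * t)|
          ≤ C * (1 / δ) * (π * (2 * δ)) := by gcongr
        _ = 2 * π * C := by field_simp
    · rw [abs_mul, abs_mul, abs_of_pos pi_pos]
      have h5 : |(smoothTransition ∘ fun t => t / δ - 1) t| ≤ 1 := by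
        rw [Function.comp, abs_of_nonneg (smoothTransition.nonneg _)]
        exact smoothTransition.le_one _
      have h6 := abs_cos_le_one (π * t)
      calc _ ≤ 1 * (1 * π) := by gcongr
        _ = π := by ring
  have hsq : ∀ (F : ℝ → ℝ), Continuous F → ∀ a b, IntervalIntegrable F volume a b :=
    fun F hF a b => hF.intervalIntegrable a b
  have hsplit : ∀ F : ℝ → ℝ, Continuous F → ∫ t in (0 : ℝ)..1, F t =
      (∫ t in (0 : ℝ)..(2 * δ), F t) + (∫ t in (2 * δ)..(1 - 2 * δ), F t) +
        ∫ t in (1 - 2 * δ)..1, F t := by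
    intro F hF
    rw [intervalIntegral.integral_add_adjacent_intervals (hsq F hF _ _) (hsq F hF _ _),
      intervalIntegral.integral_add_adjacent_intervals (hsq F hF _ _) (hsq F hF _ _)]
  have hcosint : ∫ t in (0 : ℝ)..1, cos (π * t) ^ 2 = 1 / 2 := by
    rw [intervalIntegral.integral_comp_mul_left (fun x => cos x ^ 2) pi_ne_zero, integral_cos_sq]
    simp
    field_simp
  have hsinint : ∫ t in (0 : ℝ)..1, sin (π * t) ^ 2 = 1 / 2 := by
    rw [intervalIntegral.integral_comp_mul_left (fun x => sin x ^ 2) pi_ne_zero, integral_sin_sq]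
    simp
    field_simp
  have hle2 : (2 : ℝ) * δ ≤ 1 - 2 * δ := by linarith
  have hup : ∫ t in (0 : ℝ)..1, deriv g t ^ 2 ≤ 4 * δ * M ^ 2 + π ^ 2 / 2 := by
    rw [hsplit _ (by fun_prop)]
    have e1 : ∫ t in (0 : ℝ)..(2 * δ), deriv g t ^ 2 ≤ 2 * δ * M ^ 2 := by
      have := intervalIntegral.integral_mono_on (by positivity) (hsq (fun t => deriv g t ^ 2)
        (by fun_prop) 0 (2 * δ)) (hsq (fun _ => M ^ 2) (by fun_prop) _ _) hedge
      simpa using this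
    have e3 : ∫ t in (1 - 2 * δ)..1, deriv g t ^ 2 ≤ 2 * δ * M ^ 2 := by
      have := intervalIntegral.integral_mono_on (by linarith) (hsq (fun t => deriv g t ^ 2)
        (by fun_prop) (1 - 2 * δ) 1) (hsq (fun _ => M ^ 2) (by fun_prop) _ _)
        (fun t ht => by
          have := hedge (1 - t) ⟨by linarith [ht.2], by linarith [ht.1]⟩
          rwa [hdsymm] at this)
      simpa using this
    have e2 : ∫ t in (2 * δ)..(1 - 2 * δ), deriv g t ^ 2 ≤ π ^ 2 / 2 := by
      have h1 := intervalIntegral.integral_mono_on_of_le_Ioo hle2 (hsq (fun t => deriv g t ^ 2)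
        (by fun_prop) _ _) (hsq (fun t => π ^ 2 * cos (π * t) ^ 2) (by fun_prop) _ _)
        (fun t ht => by rw [hmid t ht, mul_pow, mul_comm])
      have h2 := hsplit (fun t => π ^ 2 * cos (π * t) ^ 2) (by fun_prop)
      have h3 : 0 ≤ ∫ t in (0 : ℝ)..(2 * δ), π ^ 2 * cos (π * t) ^ 2 :=
        intervalIntegral.integral_nonneg (by positivity) fun t _ => by positivity
      have h4 : 0 ≤ ∫ t in (1 - 2 * δ)..1, π ^ 2 * cos (π * t) ^ 2 :=
        intervalIntegral.integral_nonneg (by linarith) fun t _ => by positivity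
      rw [intervalIntegral.integral_const_mul, hcosint] at h2
      linarith
    linarith
  have hlow : 1 / 2 - 4 * δ ≤ ∫ t in (0 : ℝ)..1, g t ^ 2 := by
    have h0 := hsplit (fun t => g t ^ 2) (hgs.continuous.pow 2)
    have h2 := hsplit (fun t => sin (π * t) ^ 2) (by fun_prop)
    rw [hsinint] at h2
    have e0 : ∫ t in (2 * δ)..(1 - 2 * δ), g t ^ 2 =
        ∫ t in (2 * δ)..(1 - 2 * δ), sin (π * t) ^ 2 := by
      refine intervalIntegral.integral_congr fun t ht => ?_
      rw [uIcc_of_le hle2] at ht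
      simp only [hg]
      rw [hone t ht.1, hone (1 - t) (by linarith [ht.2]), one_mul, one_mul]
    have h3 : 0 ≤ ∫ t in (0 : ℝ)..(2 * δ), g t ^ 2 :=
      intervalIntegral.integral_nonneg (by positivity) fun t _ => by positivity
    have h4 : 0 ≤ ∫ t in (1 - 2 * δ)..1, g t ^ 2 :=
      intervalIntegral.integral_nonneg (by linarith) fun t _ => by positivity
    have hs1 : ∀ t : ℝ, sin (π * t) ^ 2 ≤ 1 := fun t => sin_sq_le_one _
    have e1 := intervalIntegral.integral_mono_on (by positivity) (hsq (fun t => sin (π * t) ^ 2)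
        (by fun_prop) 0 (2 * δ)) (hsq (fun _ => 1) (by fun_prop) _ _) fun t _ => hs1 t
    have e3 := intervalIntegral.integral_mono_on (by linarith) (hsq (fun t => sin (π * t) ^ 2)
        (by fun_prop) (1 - 2 * δ) 1) (hsq (fun _ => 1) (by fun_prop) _ _) fun t _ => hs1 t
    simp at e1 e3
    linarith
  refine ⟨g, hgs, ⟨δ, hδ0, ?_⟩, ?_⟩
  · rintro t (ht | ht)
    · have : smoothTransition (t / δ - 1) = 0 := by
        refine smoothTransition.zero_of_nonpos ?_
        have : t / δ ≤ 1 := by rw [div_le_iff₀ hδ0]; linarith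
        linarith
      simp [hg, this]
    · have : smoothTransition ((1 - t) / δ - 1) = 0 := by
        refine smoothTransition.zero_of_nonpos ?_
        have : (1 - t) / δ ≤ 1 := by rw [div_le_iff₀ hδ0]; linarith
        linarith
      simp [hg, this]
  · calc _ ≤ _ := hup
      _ < (π * η) ^ 2 * (1 / 2 - 4 * δ) := by nlinarith
      _ ≤ _ := by gcongr

/-- Rescaled trial functions: `m` pieces in the interval `[a, a + 1]`. -/
lemma exists_trial {η : ℝ} (hη : 1 < η) : ∃ ρ > 0, ∃ g : ℝ → ℝ, ContDiff ℝ (⊤ : ℕ∞) g ∧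
    (∀ t, t ≤ ρ ∨ 1 - ρ ≤ t → g t = 0) ∧
    ∀ (m : ℕ) (a κ : ℝ), 0 < m → π * η * m ≤ κ →
      ∫ t, deriv (fun t => g (m * (t - a))) t ^ 2 < κ ^ 2 * ∫ t, g (m * (t - a)) ^ 2 := by
  obtain ⟨g, hgs, ⟨ρ, hρ, h0⟩, hlt⟩ := exists_bump_unit hη
  refine ⟨ρ, hρ, g, hgs, h0, fun m a κ hm hκ => ?_⟩
  have hm' : (0 : ℝ) < m := by exact_mod_cast hm
  have hd0 : ∀ t, t ∉ Ioc (0 : ℝ) 1 → deriv g t = 0 := by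
    intro t ht
    rw [mem_Ioc, not_and_or, not_lt, not_le] at ht
    have : g =ᶠ[𝓝 t] fun _ => 0 := by
      rcases ht with h | h
      · filter_upwards [Iio_mem_nhds (show t < ρ by linarith)] with x hx
        exact h0 x (Or.inl (mem_Iio.1 hx).le)
      · filter_upwards [Ioi_mem_nhds (show 1 - ρ < t by linarith)] with x hx
        exact h0 x (Or.inr (mem_Ioi.1 hx).le)
    rw [this.deriv_eq]; simp
  have hz0 : ∀ t, t ∉ Ioc (0 : ℝ) 1 → g t = 0 := by
    intro t ht
    rw [mem_Ioc, not_and_or, not_lt, not_le] at ht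
    exact h0 t (ht.imp (fun h => by linarith) (fun h => by linarith))
  have hd : ∀ t, deriv (fun t => g (m * (t - a))) t = m * deriv g (m * (t - a)) := by
    intro t
    have h1 : HasDerivAt (fun t => (m : ℝ) * (t - a)) m t := by
      simpa using ((hasDerivAt_id t).sub_const a).const_mul (m : ℝ)
    have h2 := ((hgs.differentiable (by simp) (m * (t - a))).hasDerivAt).comp t h1
    rw [mul_comm]; exact h2.deriv
  have hsc : ∀ F : ℝ → ℝ, (∀ t, t ∉ Ioc (0 : ℝ) 1 → F t = 0) →
      ∫ t, F (m * (t - a)) = (m : ℝ)⁻¹ * ∫ t in (0 : ℝ)..1, F t := by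
    intro F hF
    rw [integral_sub_right_eq_self (fun t => F (m * t)) a, Measure.integral_comp_mul_left,
      abs_of_pos (inv_pos.2 hm'), intervalIntegral.integral_of_le zero_le_one,
      setIntegral_eq_integral_of_forall_compl_eq_zero hF, smul_eq_mul]
  simp_rw [hd, mul_pow]
  rw [integral_const_mul, hsc (fun t => deriv g t ^ 2) (fun t ht => by simp [hd0 t ht]),
    hsc (fun t => g t ^ 2) (fun t ht => by simp [hz0 t ht])]
  have hg0 : 0 ≤ ∫ t in (0 : ℝ)..1, g t ^ 2 :=
    intervalIntegral.integral_nonneg zero_le_one fun t _ => sq_nonneg _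
  have hκ2 : (π * η * m) ^ 2 ≤ κ ^ 2 := pow_le_pow_left₀ (by positivity) hκ 2
  calc (m : ℝ) ^ 2 * ((m : ℝ)⁻¹ * ∫ t in (0 : ℝ)..1, deriv g t ^ 2)
      = m * ∫ t in (0 : ℝ)..1, deriv g t ^ 2 := by field_simp
    _ < m * ((π * η) ^ 2 * ∫ t in (0 : ℝ)..1, g t ^ 2) := by gcongr
    _ = (π * η * m) ^ 2 * ((m : ℝ)⁻¹ * ∫ t in (0 : ℝ)..1, g t ^ 2) := by field_simp
    _ ≤ _ := by gcongr

lemma integral_quarter_disc {μ R : ℝ} (hμ : 0 ≤ μ) (hR : √μ ≤ R) :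
    ∫ x in (0 : ℝ)..R, √(μ - x ^ 2) = π * μ / 4 := by
  have hii : ∀ a b, IntervalIntegrable (fun x : ℝ => √(μ - x ^ 2)) volume a b := fun a b =>
    Continuous.intervalIntegrable (by fun_prop) a b
  have htail : ∫ x in (√μ)..R, √(μ - x ^ 2) = 0 := by
    rw [intervalIntegral.integral_congr (g := fun _ => 0), intervalIntegral.integral_zero]
    intro x hx
    rw [uIcc_of_le hR] at hx
    refine sqrt_eq_zero_of_nonpos ?_
    nlinarith [sq_sqrt hμ, hx.1, sqrt_nonneg μ]
  have hhalf : ∫ x in (0 : ℝ)..1, √(1 - x ^ 2) = π / 4 := by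
    have h1 := integral_sqrt_one_sub_sq
    have hii' : ∀ a b, IntervalIntegrable (fun x : ℝ => √(1 - x ^ 2)) volume a b := fun a b =>
      Continuous.intervalIntegrable (by fun_prop) a b
    rw [← intervalIntegral.integral_add_adjacent_intervals (hii' (-1) 0) (hii' 0 1)] at h1
    have h2 := intervalIntegral.integral_comp_neg (a := 0) (b := 1)
      (fun x : ℝ => √(1 - x ^ 2))
    simp only [neg_sq, neg_zero] at h2
    rw [← h2] at h1
    linarith
  rw [← intervalIntegral.integral_add_adjacent_intervals (hii 0 (√μ)) (hii (√μ) R), htail,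
    add_zero]
  have h3 := intervalIntegral.mul_integral_comp_mul_left (a := 0) (b := 1)
    (f := fun x : ℝ => √(μ - x ^ 2)) (√μ)
  rw [mul_zero, mul_one] at h3
  rw [← h3]
  have h4 : ∀ x : ℝ, √(μ - (√μ * x) ^ 2) = √μ * √(1 - x ^ 2) := by
    intro x
    rw [← sqrt_mul hμ, mul_pow, sq_sqrt hμ, mul_sub, mul_one]
  simp_rw [h4]
  rw [intervalIntegral.integral_const_mul, hhalf, ← mul_assoc, mul_self_sqrt hμ]
  ring

lemma antitoneOn_sqrt_sub_sq (μ : ℝ) : AntitoneOn (fun x : ℝ => √(μ - x ^ 2)) (Ici 0) := by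
  intro x hx y _ hxy
  refine sqrt_le_sqrt (sub_le_sub_left (pow_le_pow_left₀ hx hxy 2) _)

lemma sqrt_sub_sq_le (μ x : ℝ) : √(μ - x ^ 2) ≤ √μ :=
  sqrt_le_sqrt (by linarith [sq_nonneg x])

lemma sum_sqrt_le {μ y : ℝ} (hμ : 0 ≤ μ) (hy : 0 ≤ y) (n : ℕ) :
    ∑ i ∈ Finset.range n, √(μ - (y + i) ^ 2) ≤ π * μ / 4 + √μ := by
  have hii : ∀ a b, IntervalIntegrable (fun x : ℝ => √(μ - x ^ 2)) volume a b := fun a b =>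
    Continuous.intervalIntegrable (by fun_prop) a b
  have h1 : ∑ i ∈ Finset.range n, √(μ - (y + i) ^ 2) ≤
      ∑ i ∈ Finset.range (n + 1), √(μ - (y + i) ^ 2) := by
    rw [Finset.sum_range_succ]; linarith [sqrt_nonneg (μ - (y + n) ^ 2)]
  rw [Finset.sum_range_succ'] at h1
  have h2 := ((antitoneOn_sqrt_sub_sq μ).mono
    (fun x (hx : x ∈ Icc y (y + n)) => hy.trans hx.1)).sum_le_integral
  have h3 : ∫ x in y..y + n, √(μ - x ^ 2) ≤ π * μ / 4 := by
    set R := max (√μ) (y + n) with hR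
    rw [← integral_quarter_disc hμ (le_max_left (√μ) (y + n)), ← hR]
    have hn : (0 : ℝ) ≤ n := Nat.cast_nonneg n
    exact intervalIntegral.integral_mono_interval hy (by linarith) (le_max_right _ _)
      (Eventually.of_forall fun x => sqrt_nonneg _) (hii _ _)
  have h4 := sqrt_sub_sq_le μ (y + ((0 : ℕ) : ℝ))
  linarith

lemma le_sum_sqrt {μ y : ℝ} (hμ : 0 ≤ μ) (hy : 0 ≤ y) (hy1 : y ≤ 1) {n : ℕ} (hn : √μ ≤ n) :
    π * μ / 4 - √μ ≤ ∑ i ∈ Finset.range n, √(μ - (y + i) ^ 2) := by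
  have hii : ∀ a b, IntervalIntegrable (fun x : ℝ => √(μ - x ^ 2)) volume a b := fun a b =>
    Continuous.intervalIntegrable (by fun_prop) a b
  have h2 := ((antitoneOn_sqrt_sub_sq μ).mono
    (fun x (hx : x ∈ Icc y (y + n)) => hy.trans hx.1)).integral_le_sum
  have h3 := integral_quarter_disc hμ (show √μ ≤ y + n by linarith)
  rw [← intervalIntegral.integral_add_adjacent_intervals (hii 0 y) (hii y (y + n))] at h3
  have h4 := intervalIntegral.integral_mono_on hy (hii 0 y)
    (Continuous.intervalIntegrable continuous_const _ _) fun x _ => sqrt_sub_sq_le μ x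
  simp only [intervalIntegral.integral_const, sub_zero, smul_eq_mul] at h4
  nlinarith [sqrt_nonneg μ]

/-- The `2 n` angular momenta closest to the flux `Φ`. -/
noncomputable def momenta (Φ : ℝ) (n : ℕ) : Finset ℤ := Finset.Ico (⌈Φ⌉ - n) (⌈Φ⌉ + n)

lemma sum_momenta (Φ : ℝ) (F : ℤ → ℝ) (n : ℕ) : ∑ k ∈ momenta Φ n, F k =
    ∑ i ∈ Finset.range n, F (⌈Φ⌉ + i) + ∑ i ∈ Finset.range n, F (⌈Φ⌉ - 1 - i) := by
  induction n with
  | zero => simp [momenta]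
  | succ n ih =>
    have : momenta Φ (n + 1) = insert (⌈Φ⌉ + (n : ℤ)) (insert (⌈Φ⌉ - 1 - (n : ℤ)) (momenta Φ n)) := by
      ext k
      simp only [momenta, Finset.mem_Ico, Finset.mem_insert]
      push_cast
      omega
    rw [this, Finset.sum_insert, Finset.sum_insert, ih, Finset.sum_range_succ,
      Finset.sum_range_succ]
    · ring
    · simp only [momenta, Finset.mem_Ico]; omega
    · simp only [momenta, Finset.mem_Ico, Finset.mem_insert]; omega

lemma mem_momenta {Φ : ℝ} {n : ℕ} {k : ℤ} (h : |(k : ℝ) - Φ| < n) : k ∈ momenta Φ n := by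
  rw [abs_lt] at h
  rw [momenta, Finset.mem_Ico]
  constructor
  · have : Φ ≤ ((k + n : ℤ) : ℝ) := by push_cast; linarith
    have := Int.ceil_le.2 this
    omega
  · have : ((k - n : ℤ) : ℝ) < ⌈Φ⌉ := lt_of_lt_of_le (by push_cast; linarith) (Int.le_ceil Φ)
    have : k - n < ⌈Φ⌉ := by exact_mod_cast this
    omega

lemma card_momenta_lt_le (Φ : ℝ) (K : Finset ℤ) {μ : ℝ} :
    ((K.filter fun k : ℤ => ((k : ℝ) - Φ) ^ 2 < μ).card : ℝ) ≤ 2 * √μ + 1 := by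
  have hsub : (K.filter fun k : ℤ => ((k : ℝ) - Φ) ^ 2 < μ) ⊆
      Finset.Icc ⌈Φ - √μ⌉ ⌊Φ + √μ⌋ := by
    intro k hk
    rw [Finset.mem_filter] at hk
    have h1 := abs_lt.1 (lt_sqrt_of_sq_lt (by rw [sq_abs]; exact hk.2) : |(k : ℝ) - Φ| < √μ)
    rw [Finset.mem_Icc, Int.ceil_le, Int.le_floor]
    constructor <;> linarith
  have h1 := Finset.card_le_card hsub
  rw [Int.card_Icc] at h1
  have h2 : (((⌊Φ + √μ⌋ + 1 - ⌈Φ - √μ⌉).toNat : ℤ) : ℝ) ≤ 2 * √μ + 1 := by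
    rw [Int.toNat_eq_max, Int.cast_max, max_le_iff]
    constructor
    · push_cast
      linarith [Int.floor_le (Φ + √μ), Int.le_ceil (Φ - √μ)]
    · push_cast; positivity
  have h3 : ((K.filter fun k : ℤ => ((k : ℝ) - Φ) ^ 2 < μ).card : ℝ) ≤
    ((⌊Φ + √μ⌋ + 1 - ⌈Φ - √μ⌉).toNat : ℝ) := by exact_mod_cast h1
  exact h3.trans (by exact_mod_cast h2)

lemma mul_sqrt_le {ε : ℝ} (hε : 0 < ε) (A : ℝ) {μ : ℝ} (hμ : 0 ≤ μ) :
    A * √μ ≤ ε * μ + A ^ 2 / (4 * ε) := by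
  have h : 0 ≤ (ε * √μ - A / 2) ^ 2 / ε := by positivity
  have : (ε * √μ - A / 2) ^ 2 / ε = ε * μ + A ^ 2 / (4 * ε) - A * √μ := by
    rw [sub_sq, mul_pow, sq_sqrt hμ]; field_simp; ring
  linarith

lemma sum_momenta_sqrt (Φ μ : ℝ) (n : ℕ) : ∑ k ∈ momenta Φ n, √(μ - ((k : ℝ) - Φ) ^ 2) =
    ∑ i ∈ Finset.range n, √(μ - ((⌈Φ⌉ - Φ) + i) ^ 2) +
    ∑ i ∈ Finset.range n, √(μ - ((1 - (⌈Φ⌉ - Φ)) + i) ^ 2) := by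
  rw [sum_momenta]
  congr 1
  · refine Finset.sum_congr rfl fun i _ => ?_
    congr 2; push_cast; ring
  · refine Finset.sum_congr rfl fun i _ => ?_
    congr 2; push_cast; ring

lemma lattice_upper {ε : ℝ} (hε : 0 < ε) : ∃ C : ℝ, 0 ≤ C ∧ ∀ (Φ μ : ℝ) (n : ℕ), 0 ≤ μ →
    ∑ k ∈ (momenta Φ n).filter (fun k : ℤ => ((k : ℝ) - Φ) ^ 2 < μ),
      (√(μ - ((k : ℝ) - Φ) ^ 2) / π + 2) ≤ (1 / 2 + ε) * μ + C := by
  refine ⟨6 ^ 2 / (4 * ε) + 2, by positivity, fun Φ μ n hμ => ?_⟩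
  have hc0 : 0 ≤ (⌈Φ⌉ : ℝ) - Φ := sub_nonneg.2 (Int.le_ceil Φ)
  have hc1 : 0 ≤ 1 - ((⌈Φ⌉ : ℝ) - Φ) := by linarith [Int.ceil_lt_add_one Φ]
  have h1 := sum_sqrt_le hμ hc0 n
  have h2 := sum_sqrt_le hμ hc1 n
  have h3 : ∑ k ∈ (momenta Φ n).filter (fun k : ℤ => ((k : ℝ) - Φ) ^ 2 < μ),
      √(μ - ((k : ℝ) - Φ) ^ 2) ≤ ∑ k ∈ momenta Φ n, √(μ - ((k : ℝ) - Φ) ^ 2) :=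
    Finset.sum_le_sum_of_subset_of_nonneg (Finset.filter_subset _ _)
      fun _ _ _ => sqrt_nonneg _
  rw [sum_momenta_sqrt] at h3
  have h4 := card_momenta_lt_le Φ (momenta Φ n) (μ := μ)
  have h5 := mul_sqrt_le hε 6 hμ
  rw [Finset.sum_add_distrib, ← Finset.sum_div, Finset.sum_const, nsmul_eq_mul]
  have h6 : (∑ k ∈ (momenta Φ n).filter (fun k : ℤ => ((k : ℝ) - Φ) ^ 2 < μ),
      √(μ - ((k : ℝ) - Φ) ^ 2)) / π ≤ μ / 2 + 2 * √μ := by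
    rw [div_le_iff₀ pi_pos]
    nlinarith [pi_gt_three, sqrt_nonneg μ]
  linarith

lemma lattice_lower {ε η : ℝ} (hε : 0 < ε) (hη : 1 ≤ η) : ∃ C : ℝ, 0 ≤ C ∧
    ∀ (Φ μ : ℝ) (n : ℕ), 0 ≤ μ → √μ ≤ n →
    (1 / (2 * η) - ε) * μ - C ≤
      ∑ k ∈ momenta Φ n, (⌊√(μ - ((k : ℝ) - Φ) ^ 2) / (π * η)⌋₊ : ℝ) := by
  refine ⟨4 ^ 2 / (4 * ε) + 1, by positivity, fun Φ μ n hμ hn => ?_⟩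
  have hc0 : 0 ≤ (⌈Φ⌉ : ℝ) - Φ := sub_nonneg.2 (Int.le_ceil Φ)
  have hc1 : 0 ≤ 1 - ((⌈Φ⌉ : ℝ) - Φ) := by linarith [Int.ceil_lt_add_one Φ]
  have h1 := le_sum_sqrt hμ hc0 (by linarith) hn
  have h2 := le_sum_sqrt hμ hc1 (by linarith) hn
  have h4 := card_momenta_lt_le Φ (momenta Φ n) (μ := μ)
  have h5 := mul_sqrt_le hε 4 hμ
  have hterm : ∀ k ∈ momenta Φ n, √(μ - ((k : ℝ) - Φ) ^ 2) / (π * η) -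
      (if ((k : ℝ) - Φ) ^ 2 < μ then 1 else 0) ≤
      (⌊√(μ - ((k : ℝ) - Φ) ^ 2) / (π * η)⌋₊ : ℝ) := by
    intro k _
    split_ifs with h
    · linarith [Nat.lt_floor_add_one (√(μ - ((k : ℝ) - Φ) ^ 2) / (π * η))]
    · rw [sqrt_eq_zero_of_nonpos (by linarith)]; simp
  have h6 := Finset.sum_le_sum hterm
  rw [Finset.sum_sub_distrib, ← Finset.sum_div, Finset.sum_ite, sum_momenta_sqrt] at h6
  simp only [Finset.sum_const_zero, Finset.sum_const, nsmul_eq_mul, mul_one, add_zero] at h6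
  have h7 : 1 / (2 * η) * μ - 2 * √μ ≤ (∑ i ∈ Finset.range n, √(μ - ((⌈Φ⌉ - Φ) + i) ^ 2) +
      ∑ i ∈ Finset.range n, √(μ - ((1 - (⌈Φ⌉ - Φ)) + i) ^ 2)) / (π * η) := by
    rw [le_div_iff₀ (by positivity)]
    have e : (1 / (2 * η) * μ - 2 * √μ) * (π * η) = π * μ / 2 - 2 * √μ * (π * η) := by
      field_simp
    have e2 : 2 * √μ * 1 ≤ 2 * √μ * (π * η) :=
      mul_le_mul_of_nonneg_left (by nlinarith [pi_gt_three]) (by positivity)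
    rw [e]; linarith
  linarith

/-- Logarithmic polar coordinates. -/
noncomputable def logPolar (p : ℝ × ℝ) : ℝ × ℝ := (exp p.1 * cos p.2, exp p.1 * sin p.2)

lemma contDiff_logPolar : ContDiff ℝ (⊤ : ℕ∞) logPolar := by
  unfold logPolar
  fun_prop

lemma sqnorm_logPolar (p : ℝ × ℝ) : sqnorm (logPolar p) = exp (2 * p.1) := by
  have : exp (2 * p.1) = exp p.1 ^ 2 := by rw [← exp_nat_mul]; norm_num
  rw [this, sqnorm, logPolar]
  linear_combination exp p.1 ^ 2 * sin_sq_add_cos_sq p.2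

lemma sqnorm_pos_of_ne {x : ℝ × ℝ} (hx : x ≠ 0) : 0 < sqnorm x := by
  rw [sqnorm]
  by_contra h
  have h1 : x.1 = 0 := by nlinarith [sq_nonneg x.1, sq_nonneg x.2]
  have h2 : x.2 = 0 := by nlinarith [sq_nonneg x.1, sq_nonneg x.2]
  exact hx (Prod.ext h1 h2)

lemma continuous_sqnorm : Continuous sqnorm := by unfold sqnorm; fun_prop

lemma log_logPolar (p : ℝ × ℝ) : log (√(sqnorm (logPolar p))) = p.1 := by
  rw [sqnorm_logPolar, log_sqrt (exp_pos _).le, log_exp]; ring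

/-- The strip `ℝ × (-π, π)`. -/
def strip : Set (ℝ × ℝ) := univ ×ˢ Ioo (-π) π

lemma integral_logPolar (F : ℝ × ℝ → ℝ) :
    ∫ x, F x = ∫ p in strip, exp (2 * p.1) * F (logPolar p) := by
  rw [← integral_comp_polarCoord_symm]
  set f : ℝ × ℝ → ℝ × ℝ := fun p => (exp p.1, p.2) with hf
  set f' : ℝ × ℝ → (ℝ × ℝ →L[ℝ] ℝ × ℝ) := fun p =>
    ((exp p.1) • ContinuousLinearMap.id ℝ ℝ).prodMap (ContinuousLinearMap.id ℝ ℝ) with hf'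
  have himg : f '' strip = polarCoord.target := by
    ext q
    simp only [hf, strip, mem_image, mem_prod, mem_univ, true_and, polarCoord_target, mem_Ioi]
    constructor
    · rintro ⟨p, hp, rfl⟩; exact ⟨exp_pos _, hp⟩
    · rintro ⟨h1, h2⟩
      exact ⟨(log q.1, q.2), h2, by simp [exp_log h1]⟩
  have hder : ∀ p ∈ strip, HasFDerivWithinAt f (f' p) strip p := by
    intro p _
    refine HasFDerivAt.hasFDerivWithinAt ?_
    have h1 : HasFDerivAt exp ((exp p.1) • ContinuousLinearMap.id ℝ ℝ) p.1 := by
      refine (hasDerivAt_exp p.1).hasFDerivAt.congr_fderiv ?_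
      ext; simp
    exact HasFDerivAt.prodMap p h1 (hasFDerivAt_id p.2)
  have hinj : InjOn f strip := by
    intro p _ q _ h
    simp only [hf, Prod.mk.injEq, exp_eq_exp] at h
    exact Prod.ext h.1 h.2
  have hdet : ∀ p, (f' p).det = exp p.1 := by
    intro p
    have : ((f' p : ℝ × ℝ →L[ℝ] ℝ × ℝ) : ℝ × ℝ →ₗ[ℝ] ℝ × ℝ) =
      ((exp p.1) • LinearMap.id).prodMap LinearMap.id := rfl
    rw [ContinuousLinearMap.det, this, LinearMap.det_prodMap]
    simp
  have hms : MeasurableSet strip := MeasurableSet.univ.prod measurableSet_Ioo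
  rw [← himg, integral_image_eq_integral_abs_det_fderiv_smul volume hms hder hinj]
  refine setIntegral_congr_fun hms fun p _ => ?_
  simp only [hdet, abs_of_pos (exp_pos _), smul_eq_mul, hf, polarCoord_symm_apply]
  rw [two_mul, exp_add, mul_assoc]
  rfl

/-- A test function in logarithmic polar coordinates. -/
noncomputable def polarLift (u : ℝ × ℝ → ℂ) (p : ℝ × ℝ) : ℂ := u (logPolar p)

/-- The radial derivative in logarithmic polar coordinates. -/
noncomputable def radDeriv (u : ℝ × ℝ → ℂ) (p : ℝ × ℝ) : ℂ := fderiv ℝ (polarLift u) p (1, 0)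

/-- The angular derivative in logarithmic polar coordinates. -/
noncomputable def angDeriv (u : ℝ × ℝ → ℂ) (p : ℝ × ℝ) : ℂ := fderiv ℝ (polarLift u) p (0, 1)

lemma IsTestFun.contDiff_polarLift {u : ℝ × ℝ → ℂ} (hu : IsTestFun u) :
    ContDiff ℝ (⊤ : ℕ∞) (polarLift u) := hu.1.comp contDiff_logPolar

lemma IsTestFun.continuous_radDeriv {u : ℝ × ℝ → ℂ} (hu : IsTestFun u) :
    Continuous (radDeriv u) :=
  (hu.contDiff_polarLift.continuous_fderiv (by simp)).clm_apply continuous_const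

lemma IsTestFun.continuous_angDeriv {u : ℝ × ℝ → ℂ} (hu : IsTestFun u) :
    Continuous (angDeriv u) :=
  (hu.contDiff_polarLift.continuous_fderiv (by simp)).clm_apply continuous_const

lemma IsTestFun.exists_bound {u : ℝ × ℝ → ℂ} (hu : IsTestFun u) : ∃ N : ℕ,
    ∀ p : ℝ × ℝ, (N : ℝ) < |p.1| → polarLift u p = 0 ∧ fderiv ℝ (polarLift u) p = 0 := by
  obtain ⟨r, hr, h0⟩ := Metric.eventually_nhds_iff.1 hu.2.2
  obtain ⟨R, hR⟩ := hu.2.1.isCompact.isBounded.exists_norm_le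
  obtain ⟨N, hN⟩ := exists_nat_gt (max (log (2 * (|R| + 1))) (-log r))
  have hmain : ∀ p : ℝ × ℝ, (N : ℝ) < |p.1| → polarLift u p = 0 := by
    intro p hp
    rcases lt_abs.1 hp with h | h
    · by_contra hne
      have hmem := hR (logPolar p) (subset_tsupport _ hne)
      have h1 : |exp p.1 * cos p.2| ≤ R := (norm_fst_le (logPolar p)).trans hmem
      have h2 : |exp p.1 * sin p.2| ≤ R := (norm_snd_le (logPolar p)).trans hmem
      have h3 := sqnorm_logPolar p
      rw [two_mul, exp_add, sqnorm, logPolar] at h3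
      simp only at h3
      rw [← sq_abs, ← sq_abs (exp p.1 * sin p.2)] at h3
      have h4 : 2 * (|R| + 1) < exp p.1 := by
        rw [← log_lt_iff_lt_exp (by positivity)]
        exact (le_max_left _ _).trans_lt (hN.trans h)
      have h5 : |exp p.1 * cos p.2| ^ 2 ≤ R ^ 2 := pow_le_pow_left₀ (abs_nonneg _) h1 2
      have h6 : |exp p.1 * sin p.2| ^ 2 ≤ R ^ 2 := pow_le_pow_left₀ (abs_nonneg _) h2 2
      nlinarith [abs_nonneg R, sq_abs R]
    · refine h0 ?_
      have h1 : exp p.1 < r := by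
        rw [← lt_log_iff_exp_lt hr]
        have := (le_max_right (log (2 * (|R| + 1))) (-log r)).trans_lt (hN.trans h)
        linarith
      rw [dist_zero_right, Prod.norm_def, max_lt_iff]
      simp only [logPolar, norm_mul, Real.norm_eq_abs, abs_exp]
      have h2 := exp_pos p.1
      constructor
      · nlinarith [abs_cos_le_one p.2]
      · nlinarith [abs_sin_le_one p.2]
  refine ⟨N, fun p hp => ⟨hmain p hp, ?_⟩⟩
  have hop : IsOpen {p : ℝ × ℝ | (N : ℝ) < |p.1|} := isOpen_lt continuous_const (by fun_prop)
  have : polarLift u =ᶠ[𝓝 p] fun _ => 0 := by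
    filter_upwards [hop.mem_nhds hp] with q hq using hmain q hq
  rw [this.fderiv_eq]
  simp

lemma energy_density (Φ : ℝ) {u : ℝ × ℝ → ℂ} (hu : IsTestFun u) (p : ℝ × ℝ) :
    exp (2 * p.1) *
    (‖-Complex.I * fderiv ℝ u (logPolar p) (1, 0) +
        ((Φ * ((logPolar p).2 / sqnorm (logPolar p)) : ℝ) : ℂ) * u (logPolar p)‖ ^ 2 +
     ‖-Complex.I * fderiv ℝ u (logPolar p) (0, 1) +
        ((Φ * (-(logPolar p).1 / sqnorm (logPolar p)) : ℝ) : ℂ) * u (logPolar p)‖ ^ 2) =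
    ‖radDeriv u p‖ ^ 2 + ‖-Complex.I * angDeriv u p - Φ * polarLift u p‖ ^ 2 := by
  have hud := (hu.1.differentiable (by simp) (logPolar p)).hasFDerivAt
  have hE : HasFDerivAt logPolar
      (((exp p.1 * cos p.2) • ContinuousLinearMap.fst ℝ ℝ ℝ +
        (-(exp p.1 * sin p.2)) • ContinuousLinearMap.snd ℝ ℝ ℝ).prod
       ((exp p.1 * sin p.2) • ContinuousLinearMap.fst ℝ ℝ ℝ +
        (exp p.1 * cos p.2) • ContinuousLinearMap.snd ℝ ℝ ℝ)) p := by
    have h1 : HasFDerivAt (fun p : ℝ × ℝ => p.1) (ContinuousLinearMap.fst ℝ ℝ ℝ) p :=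
      hasFDerivAt_fst
    have h2 : HasFDerivAt (fun p : ℝ × ℝ => p.2) (ContinuousLinearMap.snd ℝ ℝ ℝ) p :=
      hasFDerivAt_snd
    refine HasFDerivAt.prodMk ?_ ?_
    · refine (h1.exp.mul h2.cos).congr_fderiv ?_
      ext <;> simp [mul_comm]
    · refine (h1.exp.mul h2.sin).congr_fderiv ?_
      ext <;> simp [mul_comm]
  have hcomp := (hud.comp p hE).fderiv
  have hlin : ∀ a b : ℝ, fderiv ℝ u (logPolar p) (a, b) =
      (a : ℂ) * fderiv ℝ u (logPolar p) (1, 0) + (b : ℂ) * fderiv ℝ u (logPolar p) (0, 1) := by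
    intro a b
    have : ((a, b) : ℝ × ℝ) = a • (1, 0) + b • (0, 1) := by simp
    rw [this, map_add, map_smul, map_smul]
    simp
  have hrad : radDeriv u p = ((exp p.1 * cos p.2 : ℝ) : ℂ) * fderiv ℝ u (logPolar p) (1, 0) +
      ((exp p.1 * sin p.2 : ℝ) : ℂ) * fderiv ℝ u (logPolar p) (0, 1) := by
    rw [← hlin, radDeriv, show polarLift u = u ∘ logPolar from rfl, hcomp]
    simp
  have hang : angDeriv u p = ((-(exp p.1 * sin p.2) : ℝ) : ℂ) * fderiv ℝ u (logPolar p) (1, 0) +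
      ((exp p.1 * cos p.2 : ℝ) : ℂ) * fderiv ℝ u (logPolar p) (0, 1) := by
    rw [← hlin, angDeriv, show polarLift u = u ∘ logPolar from rfl, hcomp]
    simp
  rw [hrad, hang, polarLift, sqnorm_logPolar]
  have he : exp (2 * p.1) = exp p.1 ^ 2 := by rw [← exp_nat_mul]; norm_num
  rw [he]
  simp only [logPolar]
  generalize fderiv ℝ u (exp p.1 * cos p.2, exp p.1 * sin p.2) (1, 0) = a
  generalize fderiv ℝ u (exp p.1 * cos p.2, exp p.1 * sin p.2) (0, 1) = b
  generalize u (exp p.1 * cos p.2, exp p.1 * sin p.2) = w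
  have hr := (exp_pos p.1).ne'
  have hcs := sin_sq_add_cos_sq p.2
  generalize exp p.1 = r at *
  generalize cos p.2 = c at *
  generalize sin p.2 = s at *
  simp only [← Complex.normSq_eq_norm_sq, Complex.normSq_apply, Complex.add_re, Complex.add_im,
    Complex.sub_re, Complex.sub_im, Complex.mul_re, Complex.mul_im, Complex.neg_re,
    Complex.neg_im, Complex.I_re, Complex.I_im, Complex.ofReal_re, Complex.ofReal_im]
  have e1 : Φ * (r * s / r ^ 2) = Φ * s / r := by field_simp
  have e2 : Φ * (-(r * c) / r ^ 2) = -(Φ * c / r) := by field_simp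
  rw [e1, e2]
  field_simp
  have hs2 : s ^ 2 = 1 - c ^ 2 := by linarith
  ring_nf
  simp only [hs2]
  ring_nf

lemma strip_integral {F : ℝ × ℝ → ℝ} (hF : Continuous F) {N : ℕ}
    (hN : ∀ p : ℝ × ℝ, (N : ℝ) < |p.1| → F p = 0) {S : ℝ → ℝ} (hS : Measurable S) {b : ℝ}
    (hb : ∀ t, |S t| ≤ b) :
    Integrable (fun t => S t * ∫ θ in (-π)..π, F (t, θ)) ∧
    ∫ p in strip, S p.1 * F p = ∫ t, S t * ∫ θ in (-π)..π, F (t, θ) := by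
  have hmeas : (volume : Measure (ℝ × ℝ)).restrict strip =
      (volume : Measure ℝ).prod (volume.restrict (Ioo (-π) π)) := by
    rw [strip, Measure.volume_eq_prod, ← Measure.prod_restrict, Measure.restrict_univ]
  have hFi : IntegrableOn F strip := by
    have hK : IntegrableOn F (Icc (-(N : ℝ)) N ×ˢ Icc (-π) π) :=
      hF.continuousOn.integrableOn_compact (isCompact_Icc.prod isCompact_Icc)
    refine IntegrableOn.of_forall_sdiff_eq_zero hK (MeasurableSet.univ.prod measurableSet_Ioo) ?_
    rintro p ⟨hp, hpn⟩
    refine hN p ?_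
    by_contra h
    rw [not_lt, abs_le] at h
    exact hpn ⟨h, Ioo_subset_Icc_self hp.2⟩
  have hi : Integrable (fun p : ℝ × ℝ => S p.1 * F p)
      ((volume : Measure ℝ).prod (volume.restrict (Ioo (-π) π))) := by
    rw [← hmeas]
    exact hFi.bdd_mul (hS.comp measurable_fst).aestronglyMeasurable
      (Eventually.of_forall fun p => hb p.1)
  have hin : ∀ t, ∫ θ in Ioo (-π) π, S t * F (t, θ) = S t * ∫ θ in (-π)..π, F (t, θ) := by
    intro t
    rw [integral_const_mul, intervalIntegral.integral_of_le (by linarith [pi_pos]),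
      integral_Ioc_eq_integral_Ioo]
  constructor
  · have := hi.integral_prod_left
    simpa only [hin] using this
  · rw [hmeas, integral_prod _ hi]
    simp only [hin]

/-- Magnetic energy on the circle of radius `exp t`. -/
noncomputable def circleEnergy (Φ : ℝ) (u : ℝ × ℝ → ℂ) (t : ℝ) : ℝ :=
  ∫ θ in (-π)..π, (‖radDeriv u (t, θ)‖ ^ 2 +
    ‖-Complex.I * angDeriv u (t, θ) - Φ * polarLift u (t, θ)‖ ^ 2)

/-- Mass on the circle of radius `exp t`. -/
noncomputable def circleMass (u : ℝ × ℝ → ℂ) (t : ℝ) : ℝ :=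
  ∫ θ in (-π)..π, ‖polarLift u (t, θ)‖ ^ 2

lemma IsTestFun.magEnergy_eq (Φ : ℝ) {u : ℝ × ℝ → ℂ} (hu : IsTestFun u) :
    Integrable (circleEnergy Φ u) ∧ magEnergy Φ u = ∫ t, circleEnergy Φ u t := by
  obtain ⟨N, hN⟩ := hu.exists_bound
  have h1 := hu.continuous_radDeriv
  have h2 := hu.continuous_angDeriv
  have h3 := hu.contDiff_polarLift.continuous
  obtain ⟨ha, hb⟩ := strip_integral (F := fun p => ‖radDeriv u p‖ ^ 2 +
    ‖-Complex.I * angDeriv u p - Φ * polarLift u p‖ ^ 2) (by fun_prop) (N := N)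
    (fun p hp => by simp [radDeriv, angDeriv, hN p hp]) (S := fun _ => 1) measurable_const
    (b := 1) (by simp)
  simp only [one_mul] at ha hb
  refine ⟨ha, ?_⟩
  rw [magEnergy, integral_logPolar]
  simp only [energy_density Φ hu]
  exact hb

lemma IsTestFun.potential_eq {u : ℝ × ℝ → ℂ} (hu : IsTestFun u) {S : ℝ → ℝ}
    (hS : Measurable S) {b : ℝ} (hb : ∀ t, |S t| ≤ b) :
    Integrable (fun t => S t * circleMass u t) ∧
    ∫ x, S (log (√(sqnorm x))) / sqnorm x * ‖u x‖ ^ 2 = ∫ t, S t * circleMass u t := by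
  obtain ⟨N, hN⟩ := hu.exists_bound
  have h3 := hu.contDiff_polarLift.continuous
  obtain ⟨ha, hb⟩ := strip_integral (F := fun p => ‖polarLift u p‖ ^ 2) (by fun_prop) (N := N)
    (fun p hp => by simp [hN p hp]) hS hb
  refine ⟨ha, ?_⟩
  rw [integral_logPolar]
  refine Eq.trans ?_ hb
  congr 1
  ext p
  rw [log_logPolar, sqnorm_logPolar, ← mul_assoc, mul_div_cancel₀ _ (exp_pos _).ne']
  rfl

lemma IsTestFun.integrable_radial {u : ℝ × ℝ → ℂ} (hu : IsTestFun u) {S : ℝ → ℝ}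
    (hS : Measurable S) {b : ℝ} (hb : ∀ t, |S t| ≤ b) :
    Integrable fun x => S (log (√(sqnorm x))) / sqnorm x * ‖u x‖ ^ 2 := by
  have hcont : Continuous fun x => ‖u x‖ ^ 2 / sqnorm x := by
    rw [continuous_iff_continuousAt]
    intro x
    by_cases hx : x = 0
    · have : (fun x => ‖u x‖ ^ 2 / sqnorm x) =ᶠ[𝓝 x] fun _ => 0 := by
        subst hx
        filter_upwards [hu.2.2] with y hy
        simp [hy]
      exact (continuousAt_const).congr this.symm
    · exact (hu.1.continuous.norm.pow 2).continuousAt.div continuous_sqnorm.continuousAt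
        (sqnorm_pos_of_ne hx).ne'
  have hcs : HasCompactSupport fun x => ‖u x‖ ^ 2 / sqnorm x := by
    refine hu.2.1.mono' ?_
    refine (Function.support_subset_iff'.2 fun x hx => ?_)
    simp [image_eq_zero_of_notMem_tsupport hx]
  have hm : Measurable fun x => S (log (√(sqnorm x))) :=
    hS.comp (measurable_log.comp (continuous_sqnorm.measurable.sqrt))
  refine ((hcont.integrable_of_hasCompactSupport hcs).bdd_mul hm.aestronglyMeasurable
    (Eventually.of_forall fun x => hb _)).congr (Eventually.of_forall fun x => ?_)
  simp only
  ring

lemma IsTestFun.integrable_potential {u : ℝ × ℝ → ℂ} (hu : IsTestFun u) {V : ℝ × ℝ → ℝ}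
    (hV : Measurable V) {b : ℝ} (hb : ∀ᵐ x, |V x| ≤ b) :
    Integrable fun x => V x * ‖u x‖ ^ 2 := by
  have hcs : HasCompactSupport fun x => ‖u x‖ ^ 2 := by
    refine hu.2.1.mono' ?_
    refine (Function.support_subset_iff'.2 fun x hx => ?_)
    simp [image_eq_zero_of_notMem_tsupport hx]
  exact ((hu.1.continuous.norm.pow 2).integrable_of_hasCompactSupport hcs).bdd_mul
    hV.aestronglyMeasurable hb

/-- The (unnormalised) Fourier coefficient of a function on `(-π, π)`. -/
noncomputable def mode (w : ℝ → ℂ) (k : ℤ) : ℂ :=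
  ∫ θ in (-π)..π, Complex.exp (-(k * θ * Complex.I)) * w θ

lemma norm_exp_mode (k : ℤ) (θ : ℝ) : ‖Complex.exp (-(k * θ * Complex.I))‖ = 1 := by
  have : -((k : ℂ) * θ * Complex.I) = ((-(k * θ) : ℝ) : ℂ) * Complex.I := by push_cast; ring
  rw [this, Complex.norm_exp_ofReal_mul_I]

lemma hasSum_mode {w : ℝ → ℂ} (hw : Continuous w) :
    HasSum (fun k => ‖mode w k‖ ^ 2) (2 * π * ∫ θ in (-π)..π, ‖w θ‖ ^ 2) := by
  have hab : -π < π := by linarith [pi_pos]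
  have hL : MemLp w 2 (volume.restrict (Ioc (-π) π)) := by
    rw [memLp_two_iff_integrable_sq_norm hw.aestronglyMeasurable]
    exact ((hw.norm.pow 2).continuousOn.integrableOn_Icc (a := -π) (b := π)).mono_set
      Ioc_subset_Icc_self
  have h := (hasSum_sq_fourierCoeffOn hab hL).mul_left ((2 * π) ^ 2)
  have hco : ∀ k, fourierCoeffOn hab w k = ((2 * π)⁻¹ : ℝ) • mode w k := by
    intro k
    rw [fourierCoeffOn_eq_integral, show π - -π = 2 * π by ring, one_div, mode]
    congr 1
    refine intervalIntegral.integral_congr fun θ _ => ?_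
    simp only [smul_eq_mul]
    rw [show (fourier (-k)) (θ : AddCircle (2 * π)) = Complex.exp (-(k * θ * Complex.I)) by
      rw [fourier_coe_apply]
      congr 1
      have : (π : ℂ) ≠ 0 := by exact_mod_cast pi_ne_zero
      push_cast
      field_simp]
  have hp := pi_pos
  have e1 : (fun k => ‖mode w k‖ ^ 2) = fun k => (2 * π) ^ 2 * ‖fourierCoeffOn hab w k‖ ^ 2 := by
    funext k
    rw [hco, norm_smul, mul_pow _ ‖mode w k‖, Real.norm_eq_abs, sq_abs, inv_pow, ← mul_assoc,
      mul_inv_cancel₀ (by positivity), one_mul]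
  have e2 : 2 * π * ∫ θ in (-π)..π, ‖w θ‖ ^ 2 =
      (2 * π) ^ 2 * ((π - -π)⁻¹ • ∫ θ in (-π)..π, ‖w θ‖ ^ 2) := by
    rw [smul_eq_mul, show π - -π = 2 * π by ring]
    field_simp
  rw [e1, e2]
  exact h

lemma mode_covariantDeriv {w w' : ℝ → ℂ} (hw : ∀ θ, HasDerivAt w (w' θ) θ) (hw' : Continuous w')
    (hper : w (-π) = w π) (Φ : ℝ) (k : ℤ) :
    mode (fun θ => -Complex.I * w' θ - Φ * w θ) k = (k - Φ) * mode w k := by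
  have hwc : Continuous w := continuous_iff_continuousAt.2 fun θ => (hw θ).continuousAt
  have he : ∀ θ : ℝ, HasDerivAt (fun θ : ℝ => Complex.exp (-(k * θ * Complex.I)))
      (Complex.exp (-(k * θ * Complex.I)) * (-(k * Complex.I))) θ := by
    intro θ
    have h1 : HasDerivAt (fun θ : ℝ => (θ : ℂ)) 1 θ := Complex.ofRealCLM.hasDerivAt
    have h2 := (((h1.const_mul (k : ℂ)).mul_const Complex.I).neg).cexp
    simpa using h2
  have hft := intervalIntegral.integral_deriv_mul_eq_sub (a := -π) (b := π) (fun θ _ => he θ)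
    (fun θ _ => hw θ) (Continuous.intervalIntegrable (by fun_prop) _ _)
    (hw'.intervalIntegrable _ _)
  have hend : Complex.exp (-((k : ℂ) * (π : ℝ) * Complex.I)) =
      Complex.exp (-((k : ℂ) * ((-π : ℝ) : ℂ) * Complex.I)) := by
    rw [Complex.exp_eq_exp_iff_exists_int]
    exact ⟨-k, by push_cast; ring⟩
  rw [hper, hend, sub_self] at hft
  have i1 : IntervalIntegrable (fun θ : ℝ => Complex.exp (-(k * θ * Complex.I)) * w' θ)
      volume (-π) π := Continuous.intervalIntegrable (by fun_prop) _ _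
  have i2 : IntervalIntegrable (fun θ : ℝ => Complex.exp (-(k * θ * Complex.I)) * w θ)
      volume (-π) π := Continuous.intervalIntegrable (by fun_prop) _ _
  have h1 : ∫ θ in (-π)..π, Complex.exp (-(k * θ * Complex.I)) * w' θ =
      k * Complex.I * mode w k := by
    have : (fun θ : ℝ => Complex.exp (-(k * θ * Complex.I)) * (-(k * Complex.I)) * w θ +
        Complex.exp (-(k * θ * Complex.I)) * w' θ) = fun θ : ℝ =>
        -(k * Complex.I) * (Complex.exp (-(k * θ * Complex.I)) * w θ) +
        Complex.exp (-(k * θ * Complex.I)) * w' θ := by ext θ; ring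
    rw [this, intervalIntegral.integral_add (i2.const_mul _) i1,
      intervalIntegral.integral_const_mul] at hft
    rw [mode]
    linear_combination hft
  have : (fun θ : ℝ => Complex.exp (-(k * θ * Complex.I)) * (-Complex.I * w' θ - Φ * w θ)) =
      fun θ : ℝ => -Complex.I * (Complex.exp (-(k * θ * Complex.I)) * w' θ) -
        Φ * (Complex.exp (-(k * θ * Complex.I)) * w θ) := by ext θ; ring
  rw [mode, this, intervalIntegral.integral_sub (i1.const_mul _) (i2.const_mul _),
    intervalIntegral.integral_const_mul, intervalIntegral.integral_const_mul, h1, ← mode]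
  linear_combination -(k : ℂ) * mode w k * Complex.I_mul_I

/-- The radial profile of angular momentum `k`. -/
noncomputable def radialMode (u : ℝ × ℝ → ℂ) (k : ℤ) (t : ℝ) : ℂ :=
  mode (fun θ => polarLift u (t, θ)) k

/-- The derivative of the radial profile of angular momentum `k`. -/
noncomputable def radialModeDeriv (u : ℝ × ℝ → ℂ) (k : ℤ) (t : ℝ) : ℂ :=
  mode (fun θ => radDeriv u (t, θ)) k

lemma IsTestFun.continuous_radialModeDeriv {u : ℝ × ℝ → ℂ} (hu : IsTestFun u) (k : ℤ) :
    Continuous (radialModeDeriv u k) := by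
  have h := hu.continuous_radDeriv
  refine intervalIntegral.continuous_parametric_intervalIntegral_of_continuous' ?_ _ _
  rw [Function.uncurry_def]
  fun_prop

lemma IsTestFun.hasDerivAt_rad {u : ℝ × ℝ → ℂ} (hu : IsTestFun u) (t θ : ℝ) :
    HasDerivAt (fun s => polarLift u (s, θ)) (radDeriv u (t, θ)) t :=
  HasFDerivAt.comp_hasDerivAt (f := fun s : ℝ => (s, θ)) t
    (hu.contDiff_polarLift.differentiable (by simp) (t, θ)).hasFDerivAt
    ((hasDerivAt_id t).prodMk (hasDerivAt_const t θ))

lemma IsTestFun.hasDerivAt_ang {u : ℝ × ℝ → ℂ} (hu : IsTestFun u) (t θ : ℝ) :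
    HasDerivAt (fun s => polarLift u (t, s)) (angDeriv u (t, θ)) θ :=
  HasFDerivAt.comp_hasDerivAt (f := fun s : ℝ => (t, s)) θ
    (hu.contDiff_polarLift.differentiable (by simp) (t, θ)).hasFDerivAt
    ((hasDerivAt_const θ t).prodMk (hasDerivAt_id θ))

lemma IsTestFun.hasDerivAt_radialMode {u : ℝ × ℝ → ℂ} (hu : IsTestFun u) (k : ℤ) (t : ℝ) :
    HasDerivAt (radialMode u k) (radialModeDeriv u k t) t := by
  have h0 := hu.contDiff_polarLift.continuous
  have h1 := hu.continuous_radDeriv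
  obtain ⟨C, hC⟩ := ((isCompact_Icc (a := t - 1) (b := t + 1)).prod
    (isCompact_Icc (a := -π) (b := π))).exists_bound_of_continuousOn h1.continuousOn
  refine (intervalIntegral.hasDerivAt_integral_of_dominated_loc_of_deriv_le
    (F := fun s (θ : ℝ) => Complex.exp (-(k * θ * Complex.I)) * polarLift u (s, θ))
    (F' := fun s (θ : ℝ) => Complex.exp (-(k * θ * Complex.I)) * radDeriv u (s, θ))
    (s := Icc (t - 1) (t + 1)) (bound := fun _ => C)
    (Icc_mem_nhds (by linarith) (by linarith)) ?_ ?_ ?_ ?_ ?_ ?_).2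
  · exact Eventually.of_forall fun s => Continuous.aestronglyMeasurable (by fun_prop)
  · exact Continuous.intervalIntegrable (by fun_prop) _ _
  · exact Continuous.aestronglyMeasurable (by fun_prop)
  · refine Eventually.of_forall fun θ hθ s hs => ?_
    rw [norm_mul, norm_exp_mode, one_mul]
    rw [uIoc_of_le (by linarith [pi_pos])] at hθ
    exact hC (s, θ) ⟨hs, Ioc_subset_Icc_self hθ⟩
  · exact intervalIntegrable_const
  · exact Eventually.of_forall fun θ _ s _ => (hu.hasDerivAt_rad s θ).const_mul _

lemma polarLift_periodic (u : ℝ × ℝ → ℂ) (t : ℝ) : polarLift u (t, -π) = polarLift u (t, π) := by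
  simp [polarLift, logPolar]

/-- Discarding the angular momenta outside `K` decreases the energy on a circle. -/
lemma IsTestFun.sum_mode_le {u : ℝ × ℝ → ℂ} (hu : IsTestFun u) {Φ E : ℝ} {K : Finset ℤ}
    (hK : ∀ k ∉ K, E ≤ ((k : ℝ) - Φ) ^ 2) (t : ℝ) :
    ∑ k ∈ K, (‖radialModeDeriv u k t‖ ^ 2 + (((k : ℝ) - Φ) ^ 2 - E) * ‖radialMode u k t‖ ^ 2) ≤
      2 * π * (circleEnergy Φ u t - E * circleMass u t) := by
  have h0 := hu.contDiff_polarLift.continuous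
  have h1 := hu.continuous_radDeriv
  have h2 := hu.continuous_angDeriv
  have s1 := hasSum_mode (w := fun θ => radDeriv u (t, θ)) (by fun_prop)
  have s2 := hasSum_mode (w := fun θ => -Complex.I * angDeriv u (t, θ) - Φ * polarLift u (t, θ))
    (by fun_prop)
  have s3 := hasSum_mode (w := fun θ => polarLift u (t, θ)) (by fun_prop)
  have hm : ∀ k : ℤ, ‖mode (fun θ => -Complex.I * angDeriv u (t, θ) - Φ * polarLift u (t, θ)) k‖ ^ 2
      = ((k : ℝ) - Φ) ^ 2 * ‖radialMode u k t‖ ^ 2 := by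
    intro k
    rw [mode_covariantDeriv (fun θ => hu.hasDerivAt_ang t θ) (by fun_prop) (polarLift_periodic u t),
      norm_mul, mul_pow, radialMode]
    rw [show ((k : ℂ) - Φ) = (((k : ℝ) - Φ : ℝ) : ℂ) by push_cast; rfl, Complex.norm_real,
      Real.norm_eq_abs, sq_abs]
  simp only [hm] at s2
  have s := (s1.add s2).sub (s3.mul_left E)
  have key := sum_le_hasSum K (fun k hk => ?_) s
  · refine le_trans (le_of_eq (Finset.sum_congr rfl fun k _ => ?_)) (key.trans (le_of_eq ?_))
    · rw [radialModeDeriv, radialMode]; ring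
    · rw [circleEnergy, circleMass, intervalIntegral.integral_add
        (Continuous.intervalIntegrable (by fun_prop) _ _)
        (Continuous.intervalIntegrable (by fun_prop) _ _)]
      ring
  · have := mul_le_mul_of_nonneg_right (hK k hk) (sq_nonneg ‖radialMode u k t‖)
    have h3 : ‖mode (fun θ => polarLift u (t, θ)) k‖ = ‖radialMode u k t‖ := rfl
    rw [h3]
    nlinarith [sq_nonneg ‖mode (fun θ => radDeriv u (t, θ)) k‖]

/-- The number of subintervals of a unit interval needed to control a Dirichlet problem with
strength `κ ^ 2 = e`. -/
noncomputable def meshSize (e : ℝ) : ℕ := ⌊√e / π⌋₊ + 1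

lemma sqrt_lt_meshSize (e : ℝ) : √e < π * meshSize e := by
  have := Nat.lt_floor_add_one (√e / π)
  rw [div_lt_iff₀ pi_pos] at this
  rw [meshSize]
  push_cast
  linarith

lemma IsTestFun.integrable_circle {u : ℝ × ℝ → ℂ} (hu : IsTestFun u) (Φ : ℝ) {E : ℤ → ℝ} {b : ℝ}
    (hE : ∀ j, |E j| ≤ b) :
    Integrable (fun t : ℝ => circleEnergy Φ u t - E ⌊t⌋ * circleMass u t) ∧
    ∫ t : ℝ, (circleEnergy Φ u t - E ⌊t⌋ * circleMass u t) =
      magEnergy Φ u - ∫ x, E ⌊log (√(sqnorm x))⌋ / sqnorm x * ‖u x‖ ^ 2 := by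
  obtain ⟨h1, h2⟩ := hu.magEnergy_eq Φ
  have hm : Measurable fun t : ℝ => E ⌊t⌋ := (measurable_of_countable E).comp Int.measurable_floor
  obtain ⟨h3, h4⟩ := hu.potential_eq hm (fun t => hE ⌊t⌋)
  refine ⟨h1.sub h3, ?_⟩
  rw [integral_sub h1 h3, h2, h4]

/-- A test function whose radial profiles vanish on a sufficiently fine mesh has nonnegative
total energy. -/
lemma IsTestFun.potential_le_energy {u : ℝ × ℝ → ℂ} (hu : IsTestFun u) {Φ b : ℝ} {E : ℤ → ℝ}
    {n : ℕ} (hE : ∀ j, |E j| ≤ b) (hn : √b ≤ n)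
    (hz : ∀ (j k : ℤ), ((k : ℝ) - Φ) ^ 2 < E j → ∀ i ≤ meshSize (E j - ((k : ℝ) - Φ) ^ 2),
      radialMode u k (j + i / meshSize (E j - ((k : ℝ) - Φ) ^ 2)) = 0) :
    ∫ x, E ⌊log (√(sqnorm x))⌋ / sqnorm x * ‖u x‖ ^ 2 ≤ magEnergy Φ u := by
  obtain ⟨hi, heq⟩ := hu.integrable_circle Φ hE
  rw [← sub_nonneg, ← heq]
  refine HasSum.nonneg (fun j => ?_) (hi.hasSum_intervalIntegral 0)
  rw [zero_add]
  have hK : ∀ k ∉ momenta Φ n, E j ≤ ((k : ℝ) - Φ) ^ 2 := by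
    intro k hk
    have h1 : (n : ℝ) ≤ |(k : ℝ) - Φ| := not_lt.1 fun h => hk (mem_momenta h)
    have h2 : b ≤ (n : ℝ) ^ 2 := by
      rw [← sqrt_le_left (Nat.cast_nonneg n)]
      exact hn
    calc E j ≤ b := (le_abs_self _).trans (hE j)
      _ ≤ (n : ℝ) ^ 2 := h2
      _ ≤ |(k : ℝ) - Φ| ^ 2 := pow_le_pow_left₀ (Nat.cast_nonneg n) h1 2
      _ = _ := sq_abs _
  have hfc : ∀ k, Continuous (radialMode u k) := fun k =>
    continuous_iff_continuousAt.2 fun t => (hu.hasDerivAt_radialMode k t).continuousAt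
  have hterm : ∀ k : ℤ, 0 ≤ ∫ t in (j : ℝ)..(j + 1), (‖radialModeDeriv u k t‖ ^ 2 +
      (((k : ℝ) - Φ) ^ 2 - E j) * ‖radialMode u k t‖ ^ 2) := by
    intro k
    rcases lt_or_ge (((k : ℝ) - Φ) ^ 2) (E j) with h | h
    · have := dirichlet_unit_nonneg (f := radialMode u k) (f' := radialModeDeriv u k) (a := j)
        (κ := √(E j - ((k : ℝ) - Φ) ^ 2)) (Nat.succ_pos _)
        (hu.hasDerivAt_radialMode k) (hu.continuous_radialModeDeriv k) (hz j k h) (sqrt_nonneg _)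
        (sqrt_lt_meshSize _)
      rw [sq_sqrt (by linarith)] at this
      refine this.trans (le_of_eq ?_)
      congr 1
      ext t
      ring
    · refine intervalIntegral.integral_nonneg (by linarith) fun t _ => ?_
      have : 0 ≤ ((k : ℝ) - Φ) ^ 2 - E j := by linarith
      positivity
  have hci : ∀ k : ℤ, Continuous fun t => ‖radialModeDeriv u k t‖ ^ 2 +
      (((k : ℝ) - Φ) ^ 2 - E j) * ‖radialMode u k t‖ ^ 2 := by
    intro k
    have := hfc k
    have := hu.continuous_radialModeDeriv k
    fun_prop
  have hsum : 0 ≤ ∫ t in (j : ℝ)..(j + 1), ∑ k ∈ momenta Φ n, (‖radialModeDeriv u k t‖ ^ 2 +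
      (((k : ℝ) - Φ) ^ 2 - E j) * ‖radialMode u k t‖ ^ 2) := by
    rw [intervalIntegral.integral_finsetSum fun k _ => (hci k).intervalIntegrable _ _]
    exact Finset.sum_nonneg fun k _ => hterm k
  have hle : ∫ t in (j : ℝ)..(j + 1), ∑ k ∈ momenta Φ n, (‖radialModeDeriv u k t‖ ^ 2 +
      (((k : ℝ) - Φ) ^ 2 - E j) * ‖radialMode u k t‖ ^ 2) ≤
      ∫ t in (j : ℝ)..(j + 1), 2 * π * (circleEnergy Φ u t - E ⌊t⌋ * circleMass u t) := by
    refine intervalIntegral.integral_mono_on_of_le_Ioo (by linarith)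
      ((continuous_finsetSum _ fun k _ => hci k).intervalIntegrable _ _)
      (hi.intervalIntegrable.const_mul _) fun t ht => ?_
    have : ⌊t⌋ = j := Int.floor_eq_iff.2 ⟨ht.1.le, ht.2⟩
    rw [this]
    exact hu.sum_mode_le hK t
  rw [intervalIntegral.integral_const_mul] at hle
  have := hsum.trans hle
  exact nonneg_of_mul_nonneg_right this (by positivity)

lemma IsTestFun.radialMode_add {u v : ℝ × ℝ → ℂ} (hu : IsTestFun u) (hv : IsTestFun v) (k : ℤ)
    (t : ℝ) : radialMode (u + v) k t = radialMode u k t + radialMode v k t := by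
  have h1 := hu.contDiff_polarLift.continuous
  have h2 := hv.contDiff_polarLift.continuous
  rw [radialMode, radialMode, radialMode, mode, mode, mode, ← intervalIntegral.integral_add
    (Continuous.intervalIntegrable (by fun_prop) _ _)
    (Continuous.intervalIntegrable (by fun_prop) _ _)]
  simp only [polarLift, Pi.add_apply, mul_add]

lemma radialMode_smul (c : ℂ) (u : ℝ × ℝ → ℂ) (k : ℤ) (t : ℝ) :
    radialMode (c • u) k t = c * radialMode u k t := by
  rw [radialMode, radialMode, mode, mode, ← intervalIntegral.integral_const_mul]
  congr 1
  ext θ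
  simp only [polarLift, Pi.smul_apply, smul_eq_mul]
  ring

/-- Bracketing bound for the dimension of negative subspaces. -/
lemma finrank_le_of_isVNegative {Φ b : ℝ} {E : ℤ → ℝ} {n : ℕ} {W : ℝ × ℝ → ℝ} (J : Finset ℤ)
    (hE : ∀ j, |E j| ≤ b) (hn : √b ≤ n) (hJ : ∀ j ∉ J, ∀ k : ℤ, E j ≤ ((k : ℝ) - Φ) ^ 2)
    (hWm : Measurable W) {B : ℝ} (hWb : ∀ᵐ x, |W x| ≤ B)
    (hW : ∀ᵐ x, W x ≤ E ⌊log (√(sqnorm x))⌋ / sqnorm x)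
    {M : Submodule ℂ (ℝ × ℝ → ℂ)} [FiniteDimensional ℂ M] (hM : IsVNegative Φ W M) :
    (Module.finrank ℂ M : ℝ) ≤ ∑ j ∈ J, ∑ k ∈ (momenta Φ n).filter
      (fun k : ℤ => ((k : ℝ) - Φ) ^ 2 < E j), (√(E j - ((k : ℝ) - Φ) ^ 2) / π + 2) := by
  classical
  set C : Finset (Σ _ : ℤ, Σ _ : ℤ, ℕ) := J.sigma fun j => ((momenta Φ n).filter
      (fun k : ℤ => ((k : ℝ) - Φ) ^ 2 < E j)).sigma
      fun k => Finset.range (meshSize (E j - ((k : ℝ) - Φ) ^ 2) + 1) with hC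
  have hcard : (C.card : ℝ) ≤ ∑ j ∈ J, ∑ k ∈ (momenta Φ n).filter
      (fun k : ℤ => ((k : ℝ) - Φ) ^ 2 < E j), (√(E j - ((k : ℝ) - Φ) ^ 2) / π + 2) := by
    rw [hC, Finset.card_sigma]
    push_cast
    refine Finset.sum_le_sum fun j _ => ?_
    rw [Finset.card_sigma]
    push_cast
    refine Finset.sum_le_sum fun k _ => ?_
    rw [Finset.card_range, meshSize]
    push_cast
    have := Nat.floor_le (a := √(E j - ((k : ℝ) - Φ) ^ 2) / π) (by positivity)
    linarith
  refine le_trans ?_ hcard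
  rw [Nat.cast_le]
  by_contra! hlt
  let T : M →ₗ[ℂ] (C → ℂ) :=
    { toFun := fun u c => radialMode u.1 c.1.2.1
        (c.1.1 + c.1.2.2 / meshSize (E c.1.1 - ((c.1.2.1 : ℝ) - Φ) ^ 2))
      map_add' := fun u v => funext fun c => (hM.1 u u.2).radialMode_add (hM.1 v v.2) _ _
      map_smul' := fun c u => funext fun _ => radialMode_smul c u.1 _ _ }
  have hker : LinearMap.ker T ≠ ⊥ := by
    refine LinearMap.ker_ne_bot_of_finrank_lt ?_
    simpa using hlt
  obtain ⟨u, hu, hu0⟩ := (Submodule.ne_bot_iff _).1 hker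
  have hT : ∀ c : C, radialMode u.1 c.1.2.1
        (c.1.1 + c.1.2.2 / meshSize (E c.1.1 - ((c.1.2.1 : ℝ) - Φ) ^ 2)) = 0 := fun c =>
    congrFun (LinearMap.mem_ker.1 hu) c
  have htest := hM.1 u u.2
  have hneg := hM.2 u u.2 (by simpa using hu0)
  have hle := htest.potential_le_energy (Φ := Φ) hE hn (fun j k hjk i hi => by
    refine hT ⟨⟨j, k, i⟩, ?_⟩
    simp only [hC, Finset.mem_sigma, Finset.mem_filter, Finset.mem_range]
    have hjJ : j ∈ J := by
      by_contra h
      exact absurd (hJ j h k) (not_le.2 hjk)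
    refine ⟨hjJ, ⟨mem_momenta ?_, hjk⟩, Nat.lt_succ_of_le hi⟩
    have h1 : |(k : ℝ) - Φ| < √b := by
      rw [lt_sqrt (abs_nonneg _), sq_abs]
      exact hjk.trans_le ((le_abs_self _).trans (hE j))
    exact h1.trans_le hn)
  have hm : Measurable fun t : ℝ => E ⌊t⌋ := (measurable_of_countable E).comp Int.measurable_floor
  have hmono : ∫ x, W x * ‖u.1 x‖ ^ 2 ≤ ∫ x, E ⌊log (√(sqnorm x))⌋ / sqnorm x * ‖u.1 x‖ ^ 2 := by
    refine integral_mono_ae (htest.integrable_potential hWm hWb)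
      (htest.integrable_radial hm (fun t => hE ⌊t⌋)) ?_
    filter_upwards [hW] with x hx using mul_le_mul_of_nonneg_right hx (sq_nonneg _)
  linarith

lemma exists_dist_int_pos {Φ : ℝ} (hΦ : ∀ k : ℤ, Φ ≠ k) :
    ∃ d : ℝ, 0 < d ∧ ∀ k : ℤ, d ≤ ((k : ℝ) - Φ) ^ 2 := by
  have h1 : (⌊Φ⌋ : ℝ) < Φ := lt_of_le_of_ne (Int.floor_le Φ) (hΦ _).symm
  have h2 := Int.lt_floor_add_one Φ
  set r := min (Φ - ⌊Φ⌋) (⌊Φ⌋ + 1 - Φ) with hr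
  have hr0 : 0 < r := lt_min (by linarith) (by linarith)
  refine ⟨r ^ 2, by positivity, fun k => ?_⟩
  rcases le_or_gt k ⌊Φ⌋ with h | h
  · have h3 : (k : ℝ) ≤ ⌊Φ⌋ := by exact_mod_cast h
    have := min_le_left (Φ - ⌊Φ⌋) (⌊Φ⌋ + 1 - Φ)
    nlinarith
  · have h3 : (⌊Φ⌋ : ℝ) + 1 ≤ k := by exact_mod_cast h
    have := min_le_right (Φ - ⌊Φ⌋) (⌊Φ⌋ + 1 - Φ)
    nlinarith

lemma exists_asymp_radius {V : ℝ × ℝ → ℝ} (hV : Tendsto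
      (fun x : ℝ × ℝ => sqnorm x * log (√(sqnorm x)) * V x) (cocompact (ℝ × ℝ)) (𝓝 1))
    {ε : ℝ} (hε : 0 < ε) : ∃ T : ℕ, 0 < T ∧ ∀ x : ℝ × ℝ, (T : ℝ) ≤ log (√(sqnorm x)) →
      1 - ε < sqnorm x * log (√(sqnorm x)) * V x ∧
      sqnorm x * log (√(sqnorm x)) * V x < 1 + ε := by
  obtain ⟨K, hK, hKs⟩ := mem_cocompact.1
    (hV (Ioo_mem_nhds (show 1 - ε < 1 by linarith) (show 1 < 1 + ε by linarith)))
  obtain ⟨R, hR⟩ := hK.isBounded.exists_norm_le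
  obtain ⟨T, hT⟩ := exists_nat_gt (max 1 (log (√(2 * R ^ 2 + 1))))
  have hT1 := (le_max_left _ _).trans_lt hT
  refine ⟨T, by exact_mod_cast zero_lt_one.trans hT1, fun x hx => hKs fun hxK => ?_⟩
  have hn := hR x hxK
  have ha : |x.1| ≤ R := (norm_fst_le x).trans hn
  have hb : |x.2| ≤ R := (norm_snd_le x).trans hn
  have hs : sqnorm x ≤ 2 * R ^ 2 + 1 := by
    rw [sqnorm]
    have := sq_le_sq' (abs_le.1 ha).1 (abs_le.1 ha).2
    have := sq_le_sq' (abs_le.1 hb).1 (abs_le.1 hb).2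
    linarith
  rcases eq_or_ne x 0 with rfl | h0
  · simp only [sqnorm, Prod.fst_zero, Prod.snd_zero] at hx
    norm_num at hx
    norm_num [hx] at hT1
  · have := log_le_log (sqrt_pos.2 (sqnorm_pos_of_ne h0)) (sqrt_le_sqrt hs)
    linarith [(le_max_right (1 : ℝ) (log (√(2 * R ^ 2 + 1)))).trans_lt hT]

lemma sqnorm_eq_exp {x : ℝ × ℝ} (hx : x ≠ 0) : sqnorm x = exp (2 * log (√(sqnorm x))) := by
  have h := sqnorm_pos_of_ne hx
  rw [log_sqrt h.le, mul_div_cancel₀ _ two_ne_zero, exp_log h]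

lemma sum_Ico_neg (f : ℤ → ℝ) (J : ℕ) : ∑ j ∈ Finset.Ico (-(J : ℤ)) J, f j =
    ∑ i ∈ Finset.range J, (f i + f (-(i + 1))) := by
  induction J with
  | zero => simp
  | succ J ih =>
    have h1 : Finset.Ico (-((J + 1 : ℕ) : ℤ)) ((J + 1 : ℕ) : ℤ) =
        insert (-((J : ℤ) + 1)) (insert (J : ℤ) (Finset.Ico (-(J : ℤ)) J)) := by
      ext k
      simp only [Finset.mem_Ico, Finset.mem_insert]
      push_cast
      omega
    rw [h1, Finset.sum_insert, Finset.sum_insert, ih, Finset.sum_range_succ]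
    · ring
    · simp
    · simp only [Finset.mem_Ico, Finset.mem_insert]
      omega

lemma sum_range_inv_le (J : ℕ) : ∑ i ∈ Finset.range J, ((i : ℝ))⁻¹ ≤ 1 + log J := by
  have h1 := harmonic_le_one_add_log J
  refine le_trans ?_ h1
  rw [harmonic]
  push_cast
  rcases J with _ | J
  · simp
  · rw [Finset.sum_range_succ', Finset.sum_range_succ]
    simp only [Nat.cast_zero, inv_zero, add_zero, Nat.cast_add, Nat.cast_one]
    have : (0 : ℝ) ≤ ((J : ℝ) + 1)⁻¹ := by positivity
    linarith

lemma sum_range_exp_neg_le (J : ℕ) : ∑ i ∈ Finset.range J, exp (-(2 * (i : ℝ))) ≤ 2 := by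
  have h : ∑ i ∈ Finset.range J, exp (-(2 * (i : ℝ))) ≤ 2 - 2 * exp (-(2 * (J : ℝ))) := by
    induction J with
    | zero => simp
    | succ J ih =>
      rw [Finset.sum_range_succ]
      push_cast
      have h1 : exp (-(2 * (J : ℝ))) = exp 2 * exp (-(2 * ((J : ℝ) + 1))) := by
        rw [← exp_add]; ring_nf
      have h2 : (2 : ℝ) ≤ exp 2 := by linarith [add_one_le_exp (2 : ℝ)]
      nlinarith [exp_pos (-(2 * ((J : ℝ) + 1)))]
  linarith [exp_pos (-(2 * (J : ℝ)))]

/-- A step function dominating a bounded potential with critical logarithmic decay. -/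
noncomputable def majorant (B ε : ℝ) (T : ℕ) (j : ℤ) : ℝ :=
  if j < T then B * exp (2 * (j + 1)) else (1 + ε) / j

lemma majorant_nonneg {B ε : ℝ} (hB : 0 ≤ B) (hε : 0 < ε) (T : ℕ) (j : ℤ) :
    0 ≤ majorant B ε T j := by
  unfold majorant
  split_ifs with h
  · positivity
  · have : (0 : ℝ) ≤ j := by
      have : (0 : ℤ) ≤ j := by omega
      exact_mod_cast this
    positivity

lemma majorant_le {B ε : ℝ} (hB : 0 ≤ B) (hε : 0 < ε) {T : ℕ} (hT : 0 < T) (j : ℤ) :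
    majorant B ε T j ≤ B * exp (2 * T) + (1 + ε) := by
  unfold majorant
  split_ifs with h
  · have h1 : (j : ℝ) + 1 ≤ T := by exact_mod_cast h
    have := mul_le_mul_of_nonneg_left (exp_le_exp.2 (show 2 * ((j : ℝ) + 1) ≤ 2 * T by linarith)) hB
    linarith
  · have h1 : (1 : ℝ) ≤ j := by
      have : (1 : ℤ) ≤ j := by omega
      exact_mod_cast this
    have : (1 + ε) / j ≤ 1 + ε := div_le_self (by linarith) h1
    have : 0 ≤ B * exp (2 * T) := by positivity
    linarith

lemma sum_majorant_le {B ε : ℝ} (hB : 0 ≤ B) (hε : 0 < ε) {T : ℕ} (hT : 0 < T) (J : ℕ) :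
    ∑ j ∈ Finset.Ico (-(J : ℤ)) J, majorant B ε T j ≤
      2 * B + T * (B * exp (2 * T) + (1 + ε)) + (1 + ε) * (1 + log J) := by
  rw [sum_Ico_neg, Finset.sum_add_distrib]
  have h1 : ∑ i ∈ Finset.range J, majorant B ε T (-((i : ℤ) + 1)) ≤ B * 2 := by
    refine le_trans (le_of_eq ?_) (mul_le_mul_of_nonneg_left (sum_range_exp_neg_le J) hB)
    rw [Finset.mul_sum]
    refine Finset.sum_congr rfl fun i _ => ?_
    rw [majorant, if_pos (by omega)]
    push_cast
    ring_nf
  have h2 : ∑ i ∈ Finset.range J, majorant B ε T (i : ℤ) ≤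
      T * (B * exp (2 * T) + (1 + ε)) + (1 + ε) * (1 + log J) := by
    have h3 : ∀ i ∈ Finset.range J, majorant B ε T (i : ℤ) ≤
        (if i < T then B * exp (2 * T) + (1 + ε) else 0) + (1 + ε) * (i : ℝ)⁻¹ := by
      intro i _
      have hi : (0 : ℝ) ≤ (1 + ε) * (i : ℝ)⁻¹ := by positivity
      split_ifs with h
      · linarith [majorant_le hB hε hT i]
      · rw [majorant, if_neg (by omega), div_eq_mul_inv]
        simp
    refine (Finset.sum_le_sum h3).trans ?_
    rw [Finset.sum_add_distrib, ← Finset.mul_sum]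
    refine add_le_add ?_ (mul_le_mul_of_nonneg_left (sum_range_inv_le J) (by linarith))
    rw [← Finset.sum_filter, Finset.sum_const, nsmul_eq_mul]
    refine mul_le_mul_of_nonneg_right ?_ (by positivity)
    have : ((Finset.range J).filter (· < T)).card ≤ (Finset.range T).card :=
      Finset.card_le_card fun i hi => by
        rw [Finset.mem_filter] at hi
        exact Finset.mem_range.2 hi.2
    rw [Finset.card_range] at this
    exact_mod_cast this
  linarith

lemma le_majorant {V : ℝ × ℝ → ℝ} {B ε : ℝ} (hB : 0 ≤ B) (hε : 0 < ε) {T : ℕ} (hT : 0 < T)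
    (hV : ∀ x : ℝ × ℝ, (T : ℝ) ≤ log (√(sqnorm x)) →
      sqnorm x * log (√(sqnorm x)) * V x < 1 + ε) {x : ℝ × ℝ} (hx : x ≠ 0) (hxB : |V x| ≤ B) :
    V x ≤ majorant B ε T ⌊log (√(sqnorm x))⌋ / sqnorm x := by
  have hs := sqnorm_pos_of_ne hx
  have he := sqnorm_eq_exp hx
  have hV' := hV x
  have hf := Int.floor_le (log (√(sqnorm x)))
  have hf' := Int.lt_floor_add_one (log (√(sqnorm x)))
  set t := log (√(sqnorm x)) with ht
  rw [le_div_iff₀ hs]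
  unfold majorant
  split_ifs with h
  · calc V x * sqnorm x ≤ B * sqnorm x :=
          mul_le_mul_of_nonneg_right ((le_abs_self _).trans hxB) hs.le
      _ ≤ B * exp (2 * (⌊t⌋ + 1)) := by
          refine mul_le_mul_of_nonneg_left ?_ hB
          rw [he]
          exact exp_le_exp.2 (by linarith)
  · have h1 : (T : ℝ) ≤ ⌊t⌋ := by exact_mod_cast not_lt.1 h
    have hT' : (0 : ℝ) < T := by exact_mod_cast hT
    have h2 := hV' (by linarith)
    rw [le_div_iff₀ (by linarith)]
    rcases le_or_gt (V x) 0 with h3 | h3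
    · have h4 : V x * sqnorm x ≤ 0 := mul_nonpos_of_nonpos_of_nonneg h3 hs.le
      have h5 : V x * sqnorm x * ⌊t⌋ ≤ 0 := mul_nonpos_of_nonpos_of_nonneg h4 (by linarith)
      linarith
    · have := mul_le_mul_of_nonneg_left hf (mul_pos h3 hs).le
      nlinarith

lemma exists_finrank_bound {Φ : ℝ} (hΦ : ∀ k : ℤ, Φ ≠ k) {V : ℝ × ℝ → ℝ} (hVm : Measurable V)
    (hVb : ∃ B : ℝ, ∀ᵐ x : ℝ × ℝ, |V x| ≤ B)
    (hV : Tendsto (fun x : ℝ × ℝ => sqnorm x * log (√(sqnorm x)) * V x)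
      (cocompact (ℝ × ℝ)) (𝓝 1)) {ε : ℝ} (hε : 0 < ε) :
    ∃ C : ℝ, ∀ lam : ℝ, 1 ≤ lam → ∀ M : Submodule ℂ (ℝ × ℝ → ℂ), FiniteDimensional ℂ M →
      IsVNegative Φ (fun x => lam * V x) M →
      (Module.finrank ℂ M : ℝ) ≤ (1 / 2 + ε) * (1 + ε) * (lam * log lam) + C * lam := by
  obtain ⟨B', hB'⟩ := hVb
  set B := |B'|
  have hB : 0 ≤ B := abs_nonneg _
  have hVB : ∀ᵐ x : ℝ × ℝ, |V x| ≤ B := by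
    filter_upwards [hB'] with x hx using hx.trans (le_abs_self _)
  obtain ⟨T, hT, hVT⟩ := exists_asymp_radius hV hε
  obtain ⟨d, hd, hdk⟩ := exists_dist_int_pos hΦ
  obtain ⟨C₀, hC₀, hlat⟩ := lattice_upper hε
  set b := B * exp (2 * T) + (1 + ε) with hb
  set C₁ := (1 + ε + B) / d + 1 + T with hC₁
  have hC₁1 : 1 ≤ C₁ := by
    have : 0 ≤ (1 + ε + B) / d := by positivity
    have : (0 : ℝ) ≤ T := Nat.cast_nonneg T
    linarith
  refine ⟨(1 / 2 + ε) * (2 * B + T * b + (1 + ε) * (1 + log C₁)) + 2 * C₁ * C₀,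
    fun lam hlam M hMf hM => ?_⟩
  have hlam0 : 0 < lam := by linarith
  have hsn := majorant_nonneg hB hε T
  have hsb := majorant_le hB hε hT
  set J : ℕ := ⌈lam * (1 + ε + B) / d⌉₊ + T with hJ
  have hJge : lam * (1 + ε + B) / d ≤ J := by
    have := Nat.le_ceil (lam * (1 + ε + B) / d)
    have : (0 : ℝ) ≤ T := Nat.cast_nonneg T
    rw [hJ]
    push_cast
    linarith
  have hJT : T ≤ J := Nat.le_add_left _ _
  have hJle : (J : ℝ) ≤ C₁ * lam := by
    have h1 := Nat.ceil_lt_add_one (a := lam * (1 + ε + B) / d) (by positivity)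
    have h2 : (T : ℝ) ≤ T * lam := le_mul_of_one_le_right (Nat.cast_nonneg T) hlam
    have h3 : C₁ * lam = lam * (1 + ε + B) / d + lam + T * lam := by rw [hC₁]; ring
    rw [h3, hJ]
    push_cast
    linarith
  have hJ0 : (0 : ℝ) < J := by
    have : 0 < J := by omega
    exact_mod_cast this
  obtain ⟨n, hn⟩ := exists_nat_ge √(lam * b)
  have hout : ∀ j ∉ Finset.Ico (-(J : ℤ)) J, ∀ k : ℤ,
      lam * majorant B ε T j ≤ ((k : ℝ) - Φ) ^ 2 := by
    intro j hj k
    refine le_trans ?_ (hdk k)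
    rw [div_le_iff₀ hd] at hJge
    unfold majorant
    split_ifs with h
    · have hj' : j + 1 ≤ -(J : ℤ) := by
        rw [Finset.mem_Ico] at hj
        omega
      have h1 : (j : ℝ) + 1 ≤ -J := by exact_mod_cast hj'
      have h2 : exp (2 * ((j : ℝ) + 1)) ≤ (J : ℝ)⁻¹ := by
        rw [le_inv_comm₀ (exp_pos _) hJ0, ← exp_neg]
        linarith [add_one_le_exp (-(2 * ((j : ℝ) + 1)))]
      calc lam * (B * exp (2 * (j + 1))) ≤ lam * (B * (J : ℝ)⁻¹) := by gcongr
        _ = lam * B / J := by ring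
        _ ≤ d := by
          rw [div_le_iff₀ hJ0]
          nlinarith
    · have hj' : (J : ℤ) ≤ j := by
        rw [Finset.mem_Ico] at hj
        omega
      have h1 : (J : ℝ) ≤ j := by exact_mod_cast hj'
      rw [← mul_div_assoc, div_le_iff₀ (by linarith)]
      nlinarith
  have hmain := finrank_le_of_isVNegative (Φ := Φ) (b := lam * b)
    (E := fun j => lam * majorant B ε T j) (n := n) (Finset.Ico (-(J : ℤ)) J)
    (fun j => by
      rw [abs_of_nonneg (mul_nonneg hlam0.le (hsn j))]
      exact mul_le_mul_of_nonneg_left (hsb j) hlam0.le) hn hout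
    (hVm.const_mul lam) (B := lam * B) (by
      filter_upwards [hVB] with x hx
      rw [abs_mul, abs_of_pos hlam0]
      exact mul_le_mul_of_nonneg_left hx hlam0.le) (by
      have h0 : ∀ᵐ x : ℝ × ℝ, x ≠ 0 := Measure.ae_ne volume 0
      filter_upwards [hVB, h0] with x hx hx0
      rw [mul_div_assoc]
      exact mul_le_mul_of_nonneg_left
        (le_majorant hB hε hT (fun x hx => (hVT x hx).2) hx0 hx) hlam0.le) hM
  have hlogJ : log J ≤ log C₁ + log lam := by
    rw [← log_mul (by positivity) hlam0.ne']
    exact log_le_log hJ0 hJle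
  have hsumJ := sum_majorant_le hB hε hT J
  calc (Module.finrank ℂ M : ℝ) ≤ _ := hmain
    _ ≤ ∑ j ∈ Finset.Ico (-(J : ℤ)) J, ((1 / 2 + ε) * (lam * majorant B ε T j) + C₀) :=
        Finset.sum_le_sum fun j _ => hlat Φ _ n (mul_nonneg hlam0.le (hsn j))
    _ = (1 / 2 + ε) * lam * ∑ j ∈ Finset.Ico (-(J : ℤ)) J, majorant B ε T j + 2 * J * C₀ := by
        rw [Finset.sum_add_distrib, Finset.mul_sum, Finset.sum_const, Int.card_Ico, nsmul_eq_mul,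
          show ((J : ℤ) - -J).toNat = 2 * J by omega]
        push_cast
        congr 1
        exact Finset.sum_congr rfl fun j _ => by ring
    _ ≤ (1 / 2 + ε) * lam * (2 * B + T * b + (1 + ε) * (1 + (log C₁ + log lam))) +
          2 * (C₁ * lam) * C₀ := by
        gcongr
        refine hsumJ.trans ?_
        gcongr
    _ = _ := by ring

/-- Asymptotic upper bound for the number of negative eigenvalues. -/
lemma eventually_negEigCount_le {Φ : ℝ} (hΦ : ∀ k : ℤ, Φ ≠ k) {V : ℝ × ℝ → ℝ}
    (hVm : Measurable V) (hVb : ∃ B : ℝ, ∀ᵐ x : ℝ × ℝ, |V x| ≤ B)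
    (hV : Tendsto (fun x : ℝ × ℝ => sqnorm x * log (√(sqnorm x)) * V x)
      (cocompact (ℝ × ℝ)) (𝓝 1)) {δ : ℝ} (hδ : 0 < δ) :
    ∀ᶠ lam : ℝ in atTop, negEigCount Φ (fun x => lam * V x) ≤
      ENNReal.ofReal ((1 / 2 + δ) * (lam * log lam)) := by
  set ε := min (δ / 4) (1 / 2) with hε
  have hε0 : 0 < ε := lt_min (by linarith) (by norm_num)
  have hε1 : ε ≤ δ / 4 := min_le_left _ _
  have hε2 : ε ≤ 1 / 2 := min_le_right _ _
  obtain ⟨C, hC⟩ := exists_finrank_bound hΦ hVm hVb hV hε0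
  filter_upwards [eventually_ge_atTop 1, tendsto_log_atTop.eventually_ge_atTop (C / (δ / 2))]
    with lam h1 h2
  refine iSup₂_le fun M hM => ?_
  rw [← ENNReal.ofReal_natCast]
  refine ENNReal.ofReal_le_ofReal ((hC lam h1 M hM.1 hM.2).trans ?_)
  rw [div_le_iff₀ (by linarith)] at h2
  have h3 : C * lam ≤ log lam * (δ / 2) * lam := mul_le_mul_of_nonneg_right h2 (by linarith)
  have h4 : (1 / 2 + ε) * (1 + ε) ≤ 1 / 2 + δ / 2 := by nlinarith
  have h5 : 0 ≤ lam * log lam := mul_nonneg (by linarith) (log_nonneg h1)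
  nlinarith [mul_le_mul_of_nonneg_right h4 h5]

/-- The function with angular momentum `k` and radial profile `G` in the logarithmic variable. -/
noncomputable def angularWave (k : ℤ) (G : ℝ → ℝ) (x : ℝ × ℝ) : ℂ :=
  (((√(sqnorm x))⁻¹ : ℝ) * (x.1 + x.2 * Complex.I)) ^ k * G (log (√(sqnorm x)))

lemma polarLift_angularWave (k : ℤ) (G : ℝ → ℝ) (p : ℝ × ℝ) :
    polarLift (angularWave k G) p = G p.1 * Complex.exp (k * p.2 * Complex.I) := by
  have h1 : √(sqnorm (logPolar p)) = exp p.1 := by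
    rw [sqnorm_logPolar, two_mul, exp_add, sqrt_mul_self (exp_pos _).le]
  have h2 : (((exp p.1)⁻¹ : ℝ) : ℂ) * ((logPolar p).1 + (logPolar p).2 * Complex.I) =
      Complex.exp (p.2 * Complex.I) := by
    rw [Complex.exp_mul_I, ← Complex.ofReal_cos, ← Complex.ofReal_sin]
    have : (exp p.1 : ℂ) ≠ 0 := by exact_mod_cast (exp_pos p.1).ne'
    simp only [logPolar]
    push_cast at this ⊢
    field_simp
  rw [polarLift, angularWave, h1, log_exp, h2, ← Complex.exp_int_mul, mul_comm, mul_assoc]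

lemma isTestFun_angularWave (k : ℤ) {G : ℝ → ℝ} (hG : ContDiff ℝ (⊤ : ℕ∞) G) {b : ℝ}
    (h0 : ∀ t ≤ 0, G t = 0) (hb : ∀ t, b ≤ t → G t = 0) : IsTestFun (angularWave k G) := by
  have hzero : ∀ x : ℝ × ℝ, ‖x‖ < 1 / 2 → angularWave k G x = 0 := by
    intro x hx
    have h1 : |x.1| ≤ ‖x‖ := norm_fst_le x
    have h2 : |x.2| ≤ ‖x‖ := norm_snd_le x
    have hs : sqnorm x ≤ 1 := by
      rw [sqnorm, ← sq_abs x.1, ← sq_abs x.2]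
      nlinarith [abs_nonneg x.1, abs_nonneg x.2]
    have : log (√(sqnorm x)) ≤ 0 := log_nonpos (sqrt_nonneg _) (sqrt_le_iff.2 ⟨zero_le_one, by simpa using hs⟩)
    rw [angularWave, h0 _ this]
    simp
  have hev : ∀ᶠ x in 𝓝 (0 : ℝ × ℝ), angularWave k G x = 0 := by
    filter_upwards [Metric.ball_mem_nhds (0 : ℝ × ℝ) (show (0 : ℝ) < 1 / 2 by norm_num)] with x hx
    exact hzero x (mem_ball_zero_iff.1 hx)
  refine ⟨contDiff_iff_contDiffAt.2 fun x => ?_, ?_, hev⟩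
  · by_cases hx : x = 0
    · subst hx
      exact (contDiffAt_const (c := (0 : ℂ))).congr_of_eventuallyEq hev
    · have hpos := sqnorm_pos_of_ne hx
      have hsq : ContDiffAt ℝ (⊤ : ℕ∞) (fun x => √(sqnorm x)) x := by
        refine ContDiffAt.sqrt ?_ hpos.ne'
        unfold sqnorm
        fun_prop
      have hlog : ContDiffAt ℝ (⊤ : ℕ∞) (fun x => G (log (√(sqnorm x)))) x :=
        hG.contDiffAt.comp x (hsq.log (sqrt_pos.2 hpos).ne')
      have hinv : ContDiffAt ℝ (⊤ : ℕ∞) (fun x => (√(sqnorm x))⁻¹) x :=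
        hsq.inv (sqrt_pos.2 hpos).ne'
      have hof : ∀ {f : ℝ × ℝ → ℝ}, ContDiffAt ℝ (⊤ : ℕ∞) f x →
          ContDiffAt ℝ (⊤ : ℕ∞) (fun x => (f x : ℂ)) x := fun hf =>
        Complex.ofRealCLM.contDiff.contDiffAt.comp x hf
      have hz : ContDiffAt ℝ (⊤ : ℕ∞) (fun x : ℝ × ℝ =>
          (((√(sqnorm x))⁻¹ : ℝ) * (x.1 + x.2 * Complex.I) : ℂ)) x :=
        (hof hinv).mul ((hof contDiffAt_fst).add ((hof contDiffAt_snd).mul contDiffAt_const))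
      have hz0 : (((√(sqnorm x))⁻¹ : ℝ) * (x.1 + x.2 * Complex.I) : ℂ) ≠ 0 := by
        refine mul_ne_zero (by exact_mod_cast (inv_pos.2 (sqrt_pos.2 hpos)).ne') fun h => hx ?_
        have h1 := congrArg Complex.re h
        have h2 := congrArg Complex.im h
        simp at h1 h2
        exact Prod.ext h1 h2
      refine ContDiffAt.mul ?_ (hof hlog)
      rcases k with k | k
      · simp only [Int.ofNat_eq_natCast, zpow_natCast]
        exact hz.pow k
      · simp only [zpow_negSucc]
        exact (hz.pow _).inv (pow_ne_zero _ hz0)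
  · refine HasCompactSupport.intro (isCompact_closedBall (0 : ℝ × ℝ) (exp b)) fun x hx => ?_
    rw [mem_closedBall_zero_iff, not_le] at hx
    have h3 : exp b ≤ √(sqnorm x) := by
      refine hx.le.trans ?_
      rw [Prod.norm_def, max_le_iff, sqnorm]
      constructor
      · exact abs_le_sqrt (by nlinarith [sq_nonneg x.2])
      · exact abs_le_sqrt (by nlinarith [sq_nonneg x.1])
    rw [angularWave, hb _ ((le_log_iff_exp_le ((exp_pos b).trans_le h3)).2 h3)]
    simp

lemma isTestFun_zero : IsTestFun 0 := by
  refine ⟨contDiff_const, HasCompactSupport.zero, Eventually.of_forall fun x => rfl⟩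

lemma IsTestFun.add {u v : ℝ × ℝ → ℂ} (hu : IsTestFun u) (hv : IsTestFun v) :
    IsTestFun (u + v) := by
  refine ⟨hu.1.add hv.1, hu.2.1.add hv.2.1, ?_⟩
  filter_upwards [hu.2.2, hv.2.2] with x h1 h2
  simp [h1, h2]

lemma IsTestFun.smul (c : ℂ) {u : ℝ × ℝ → ℂ} (hu : IsTestFun u) : IsTestFun (c • u) := by
  refine ⟨hu.1.const_smul c, hu.2.1.smul_left (f := fun _ => c), ?_⟩
  filter_upwards [hu.2.2] with x h1
  simp [h1]

lemma isTestFun_sum {ι : Type*} (s : Finset ι) {u : ι → ℝ × ℝ → ℂ} (hu : ∀ a, IsTestFun (u a)) :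
    IsTestFun (∑ a ∈ s, u a) :=
  Finset.sum_induction u IsTestFun (fun _ _ => IsTestFun.add) isTestFun_zero fun a _ => hu a

lemma integral_exp_int {k : ℤ} (hk : k ≠ 0) :
    ∫ θ in (-π)..π, Complex.exp (k * Complex.I * θ) = 0 := by
  have hc : (k : ℂ) * Complex.I ≠ 0 := mul_ne_zero (by exact_mod_cast hk) Complex.I_ne_zero
  rw [integral_exp_mul_complex hc]
  have : Complex.exp (k * Complex.I * (π : ℝ)) = Complex.exp (k * Complex.I * ((-π : ℝ) : ℂ)) := by
    rw [Complex.exp_eq_exp_iff_exists_int]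
    exact ⟨k, by push_cast; ring⟩
  rw [this, sub_self, zero_div]

lemma integral_norm_sq_sum {ι : Type*} [Fintype ι] (k : ι → ℤ) (b : ι → ℂ)
    (hb : ∀ a a', a ≠ a' → k a = k a' → b a * b a' = 0) :
    ∫ θ in (-π)..π, ‖∑ a, b a * Complex.exp (k a * θ * Complex.I)‖ ^ 2 =
      2 * π * ∑ a, ‖b a‖ ^ 2 := by
  classical
  have hpt : ∀ θ : ℝ, ((‖∑ a, b a * Complex.exp (k a * θ * Complex.I)‖ ^ 2 : ℝ) : ℂ) =
      ∑ a, ∑ a', b a * (starRingEnd ℂ) (b a') *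
        Complex.exp (((k a - k a' : ℤ) : ℂ) * Complex.I * θ) := by
    intro θ
    push_cast
    rw [← Complex.mul_conj', map_sum, Finset.sum_mul_sum]
    refine Finset.sum_congr rfl fun a _ => Finset.sum_congr rfl fun a' _ => ?_
    rw [map_mul, ← Complex.exp_conj]
    have : Complex.exp (((k a : ℂ) - k a') * Complex.I * θ) =
        Complex.exp (k a * θ * Complex.I) *
          Complex.exp ((starRingEnd ℂ) (k a' * θ * Complex.I)) := by
      rw [← Complex.exp_add]
      congr 1
      simp only [map_mul, map_intCast, Complex.conj_ofReal, Complex.conj_I]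
      ring
    rw [this]
    ring
  rw [← Complex.ofReal_inj, ← intervalIntegral.integral_ofReal]
  simp only [hpt]
  rw [intervalIntegral.integral_finsetSum fun a _ =>
    Continuous.intervalIntegrable (by fun_prop) _ _]
  push_cast
  rw [Finset.mul_sum]
  refine Finset.sum_congr rfl fun a _ => ?_
  rw [intervalIntegral.integral_finsetSum fun a _ =>
    Continuous.intervalIntegrable (by fun_prop) _ _, Finset.sum_eq_single a]
  · rw [← Complex.mul_conj']
    simp
    ring
  · intro a' _ hne
    rw [intervalIntegral.integral_const_mul]
    by_cases hk : k a = k a'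
    · rcases mul_eq_zero.1 (hb a a' hne.symm hk) with h | h <;> simp [h]
    · have := integral_exp_int (sub_ne_zero.2 hk)
      push_cast at this ⊢
      rw [this, mul_zero]
  · simp

lemma integrable_sq_of_hasCompactSupport {f : ℝ → ℝ} (hf : Continuous f)
    (hc : HasCompactSupport f) : Integrable fun t => f t ^ 2 := by
  have h : Continuous fun t => f t ^ 2 := hf.pow 2
  refine h.integrable_of_hasCompactSupport (hc.mono' ?_)
  exact Function.support_subset_iff'.2 fun x hx => by simp [image_eq_zero_of_notMem_tsupport hx]

section Superposition

variable {ι : Type*} [Fintype ι]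

lemma polarLift_sum (k : ι → ℤ) (G : ι → ℝ → ℝ) (c : ι → ℂ) (p : ℝ × ℝ) :
    polarLift (∑ a, c a • angularWave (k a) (G a)) p =
      ∑ a, c a * G a p.1 * Complex.exp (k a * p.2 * Complex.I) := by
  have : polarLift (∑ a, c a • angularWave (k a) (G a)) p =
      ∑ a, c a * polarLift (angularWave (k a) (G a)) p := by
    simp [polarLift]
  rw [this]
  simp only [polarLift_angularWave, mul_assoc]

lemma radDeriv_sum {k : ι → ℤ} {G : ι → ℝ → ℝ} (hG : ∀ a, ContDiff ℝ (⊤ : ℕ∞) (G a)) {c : ι → ℂ}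
    (hu : IsTestFun (∑ a, c a • angularWave (k a) (G a))) (t θ : ℝ) :
    radDeriv (∑ a, c a • angularWave (k a) (G a)) (t, θ) =
      ∑ a, c a * deriv (G a) t * Complex.exp (k a * θ * Complex.I) := by
  refine (hu.hasDerivAt_rad t θ).unique ?_
  simp only [polarLift_sum]
  refine HasDerivAt.fun_sum fun a _ => ?_
  have h := ((hG a).differentiable (by simp) t).hasDerivAt.ofReal_comp
  exact (h.const_mul (c a)).mul_const _

lemma angDeriv_sum {k : ι → ℤ} {G : ι → ℝ → ℝ} {c : ι → ℂ}
    (hu : IsTestFun (∑ a, c a • angularWave (k a) (G a))) (t θ : ℝ) :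
    angDeriv (∑ a, c a • angularWave (k a) (G a)) (t, θ) =
      ∑ a, c a * G a t * (Complex.exp (k a * θ * Complex.I) * (k a * Complex.I)) := by
  refine (hu.hasDerivAt_ang t θ).unique ?_
  simp only [polarLift_sum]
  refine HasDerivAt.fun_sum fun a _ => ?_
  have h1 : HasDerivAt (fun θ : ℝ => (θ : ℂ)) 1 θ := Complex.ofRealCLM.hasDerivAt
  have h2 := ((h1.const_mul (k a : ℂ)).mul_const Complex.I).cexp
  rw [mul_one] at h2
  exact h2.const_mul _

lemma circleMass_sum {k : ι → ℤ} {G : ι → ℝ → ℝ} {c : ι → ℂ}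
    (hd : ∀ a a', a ≠ a' → k a = k a' → ∀ t, G a t * G a' t = 0) (t : ℝ) :
    circleMass (∑ a, c a • angularWave (k a) (G a)) t = 2 * π * ∑ a, ‖c a‖ ^ 2 * G a t ^ 2 := by
  rw [circleMass]
  simp only [polarLift_sum]
  rw [integral_norm_sq_sum k (fun a => c a * G a t)]
  · simp only [norm_mul, mul_pow, Complex.norm_real, Real.norm_eq_abs, sq_abs]
  · intro a a' h1 h2
    have : ((G a t * G a' t : ℝ) : ℂ) = 0 := by rw [hd a a' h1 h2 t]; simp
    push_cast at this
    linear_combination c a * c a' * this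

lemma circleEnergy_sum (Φ : ℝ) {k : ι → ℤ} {G : ι → ℝ → ℝ} {c : ι → ℂ}
    (hG : ∀ a, ContDiff ℝ (⊤ : ℕ∞) (G a))
    (hu : IsTestFun (∑ a, c a • angularWave (k a) (G a)))
    (hd : ∀ a a', a ≠ a' → k a = k a' → ∀ t, G a t * G a' t = 0)
    (hd' : ∀ a a', a ≠ a' → k a = k a' → ∀ t, deriv (G a) t * deriv (G a') t = 0) (t : ℝ) :
    circleEnergy Φ (∑ a, c a • angularWave (k a) (G a)) t =
      2 * π * ∑ a, ‖c a‖ ^ 2 * (deriv (G a) t ^ 2 + ((k a : ℝ) - Φ) ^ 2 * G a t ^ 2) := by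
  have h0 := hu.contDiff_polarLift.continuous
  have h1 := hu.continuous_radDeriv
  have h2 := hu.continuous_angDeriv
  rw [circleEnergy, intervalIntegral.integral_add
        (Continuous.intervalIntegrable (by fun_prop) _ _)
        (Continuous.intervalIntegrable (by fun_prop) _ _)]
  have e : ∀ θ : ℝ, -Complex.I * angDeriv (∑ a, c a • angularWave (k a) (G a)) (t, θ) -
      Φ * polarLift (∑ a, c a • angularWave (k a) (G a)) (t, θ) =
      ∑ a, (c a * (((k a : ℝ) - Φ : ℝ) * G a t)) * Complex.exp (k a * θ * Complex.I) := by
    intro θ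
    rw [angDeriv_sum hu, polarLift_sum, Finset.mul_sum, Finset.mul_sum, ← Finset.sum_sub_distrib]
    refine Finset.sum_congr rfl fun a _ => ?_
    push_cast
    linear_combination -(c a * G a t * Complex.exp (k a * θ * Complex.I) * k a) * Complex.I_mul_I
  simp only [e, radDeriv_sum hG hu]
  rw [integral_norm_sq_sum k (fun a => c a * deriv (G a) t),
    integral_norm_sq_sum k (fun a => c a * (((k a : ℝ) - Φ : ℝ) * G a t)), ← mul_add,
    ← Finset.sum_add_distrib]
  · simp only [norm_mul, mul_pow, Complex.norm_real, Real.norm_eq_abs, sq_abs, mul_add]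
  · intro a a' h1 h2
    have : ((G a t * G a' t : ℝ) : ℂ) = 0 := by rw [hd a a' h1 h2 t]; simp
    push_cast at this
    linear_combination c a * c a' * (((k a : ℝ) - Φ : ℝ) : ℂ) * (((k a' : ℝ) - Φ : ℝ) : ℂ) * this
  · intro a a' h1 h2
    have : ((deriv (G a) t * deriv (G a') t : ℝ) : ℂ) = 0 := by rw [hd' a a' h1 h2 t]; simp
    push_cast at this
    linear_combination c a * c a' * this

lemma energy_sum_lt {Φ b B : ℝ} {E : ℤ → ℝ} (hE : ∀ j, |E j| ≤ b) {W : ℝ × ℝ → ℝ}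
    (hWm : Measurable W) (hWb : ∀ᵐ x, |W x| ≤ B) {k j : ι → ℤ}
    (hW : ∀ x, ∀ a, ⌊log (√(sqnorm x))⌋ = j a → E (j a) / sqnorm x ≤ W x)
    {G : ι → ℝ → ℝ} (hG : ∀ a, ContDiff ℝ (⊤ : ℕ∞) (G a))
    (hs : ∀ a, ∀ t ∉ Ioo (j a : ℝ) (j a + 1), G a t = 0)
    (hd : ∀ a a', a ≠ a' → k a = k a' → ∀ t, G a t * G a' t = 0)
    (hd' : ∀ a a', a ≠ a' → k a = k a' → ∀ t, deriv (G a) t * deriv (G a') t = 0)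
    (hneg : ∀ a, ∫ t, deriv (G a) t ^ 2 < (E (j a) - ((k a : ℝ) - Φ) ^ 2) * ∫ t, G a t ^ 2)
    {c : ι → ℂ} (hc : c ≠ 0) (hu : IsTestFun (∑ a, c a • angularWave (k a) (G a))) :
    magEnergy Φ (∑ a, c a • angularWave (k a) (G a)) <
      ∫ x, W x * ‖(∑ a, c a • angularWave (k a) (G a)) x‖ ^ 2 := by
  have hm : Measurable fun t : ℝ => E ⌊t⌋ := (measurable_of_countable E).comp Int.measurable_floor
  have hGc : ∀ a, HasCompactSupport (G a) := fun a =>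
    HasCompactSupport.intro (isCompact_Icc (a := (j a : ℝ)) (b := j a + 1)) fun t ht =>
      hs a t fun h => ht (Ioo_subset_Icc_self h)
  have hi1 : ∀ a, Integrable fun t => G a t ^ 2 := fun a =>
    integrable_sq_of_hasCompactSupport (hG a).continuous (hGc a)
  have hi2 : ∀ a, Integrable fun t => deriv (G a) t ^ 2 := fun a =>
    integrable_sq_of_hasCompactSupport ((hG a).continuous_deriv (by simp)) (hGc a).deriv
  have hmono : ∫ x, E ⌊log (√(sqnorm x))⌋ / sqnorm x *
      ‖(∑ a, c a • angularWave (k a) (G a)) x‖ ^ 2 ≤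
      ∫ x, W x * ‖(∑ a, c a • angularWave (k a) (G a)) x‖ ^ 2 := by
    refine integral_mono (hu.integrable_radial hm (fun t => hE ⌊t⌋))
      (hu.integrable_potential hWm hWb) fun x => ?_
    by_cases hx : ∃ a, ⌊log (√(sqnorm x))⌋ = j a
    · obtain ⟨a, ha⟩ := hx
      refine mul_le_mul_of_nonneg_right ?_ (sq_nonneg _)
      rw [ha]
      exact hW x a ha
    · push Not at hx
      have : (∑ a, c a • angularWave (k a) (G a)) x = 0 := by
        rw [Finset.sum_apply]
        refine Finset.sum_eq_zero fun a _ => ?_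
        rw [Pi.smul_apply, angularWave, hs a]
        · simp
        · intro h
          exact hx a (Int.floor_eq_iff.2 ⟨h.1.le, h.2⟩)
      simp [this]
  obtain ⟨-, heq⟩ := hu.integrable_circle Φ hE
  have hpt : ∀ t : ℝ, circleEnergy Φ (∑ a, c a • angularWave (k a) (G a)) t -
      E ⌊t⌋ * circleMass (∑ a, c a • angularWave (k a) (G a)) t =
      2 * π * ∑ a, ‖c a‖ ^ 2 *
        (deriv (G a) t ^ 2 + (((k a : ℝ) - Φ) ^ 2 - E (j a)) * G a t ^ 2) := by
    intro t
    rw [circleEnergy_sum Φ hG hu hd hd', circleMass_sum hd, mul_left_comm, ← mul_sub,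
      Finset.mul_sum, ← Finset.sum_sub_distrib]
    congr 1
    refine Finset.sum_congr rfl fun a _ => ?_
    by_cases ht : t ∈ Ioo (j a : ℝ) (j a + 1)
    · rw [Int.floor_eq_iff.2 ⟨ht.1.le, ht.2⟩]
      ring
    · rw [hs a t ht]
      ring
  simp only [hpt] at heq
  have hq : ∀ a, Integrable fun t =>
      deriv (G a) t ^ 2 + (((k a : ℝ) - Φ) ^ 2 - E (j a)) * G a t ^ 2 := fun a =>
    (hi2 a).add ((hi1 a).const_mul _)
  rw [integral_const_mul, integral_finsetSum _ fun a _ => (hq a).const_mul _] at heq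
  simp only [integral_const_mul] at heq
  have hqn : ∀ a, ∫ t, (deriv (G a) t ^ 2 + (((k a : ℝ) - Φ) ^ 2 - E (j a)) * G a t ^ 2) < 0 := by
    intro a
    rw [integral_add (hi2 a) ((hi1 a).const_mul _), integral_const_mul]
    linarith [hneg a]
  have hlt : 2 * π * ∑ a, ‖c a‖ ^ 2 *
      ∫ t, (deriv (G a) t ^ 2 + (((k a : ℝ) - Φ) ^ 2 - E (j a)) * G a t ^ 2) < 0 := by
    refine mul_neg_of_pos_of_neg (by positivity) ?_
    obtain ⟨a₀, ha₀⟩ := Function.ne_iff.1 hc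
    refine Finset.sum_neg' (fun a _ => ?_) ⟨a₀, Finset.mem_univ _, ?_⟩
    · exact mul_nonpos_of_nonneg_of_nonpos (sq_nonneg _) (hqn a).le
    · exact mul_neg_of_pos_of_neg (pow_pos (norm_pos_iff.2 ha₀) 2) (hqn a₀)
  linarith

/-- Localised trial functions with negative energy give a lower bound for the number of negative
eigenvalues. -/
lemma card_le_negEigCount {Φ b B : ℝ} {E : ℤ → ℝ} (hE : ∀ j, |E j| ≤ b) {W : ℝ × ℝ → ℝ}
    (hWm : Measurable W) (hWb : ∀ᵐ x, |W x| ≤ B) {k j : ι → ℤ}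
    (hW : ∀ x, ∀ a, ⌊log (√(sqnorm x))⌋ = j a → E (j a) / sqnorm x ≤ W x)
    {G : ι → ℝ → ℝ} (hG : ∀ a, ContDiff ℝ (⊤ : ℕ∞) (G a))
    (hs : ∀ a, ∀ t ∉ Ioo (j a : ℝ) (j a + 1), G a t = 0)
    (hd : ∀ a a', a ≠ a' → k a = k a' → ∀ t, G a t * G a' t = 0)
    (hd' : ∀ a a', a ≠ a' → k a = k a' → ∀ t, deriv (G a) t * deriv (G a') t = 0)
    (hneg : ∀ a, ∫ t, deriv (G a) t ^ 2 < (E (j a) - ((k a : ℝ) - Φ) ^ 2) * ∫ t, G a t ^ 2)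
    (hj : ∀ a, 0 ≤ j a) : (Fintype.card ι : ℝ≥0∞) ≤ negEigCount Φ W := by
  have htest : ∀ a, IsTestFun (angularWave (k a) (G a)) := fun a =>
    isTestFun_angularWave (k a) (hG a) (b := j a + 1)
      (fun t ht => hs a t fun h => by
        have : (0 : ℝ) ≤ j a := by exact_mod_cast hj a
        linarith [h.1])
      (fun t ht => hs a t fun h => by linarith [h.2])
  have hsum : ∀ c : ι → ℂ, IsTestFun (∑ a, c a • angularWave (k a) (G a)) := fun c =>
    isTestFun_sum _ fun a => (htest a).smul (c a)
  have key : ∀ c : ι → ℂ, c ≠ 0 → magEnergy Φ (∑ a, c a • angularWave (k a) (G a)) <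
      ∫ x, W x * ‖(∑ a, c a • angularWave (k a) (G a)) x‖ ^ 2 := fun c hc =>
    energy_sum_lt hE hWm hWb hW hG hs hd hd' hneg hc (hsum c)
  set T : (ι → ℂ) →ₗ[ℂ] (ℝ × ℝ → ℂ) :=
    Fintype.linearCombination ℂ (fun a => angularWave (k a) (G a)) with hT
  have hTa : ∀ c, T c = ∑ a, c a • angularWave (k a) (G a) := fun c =>
    Fintype.linearCombination_apply ℂ _ c
  have hinj : Function.Injective T := by
    rw [← LinearMap.ker_eq_bot, LinearMap.ker_eq_bot']
    intro c hc
    by_contra hne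
    have := key c hne
    rw [← hTa, hc] at this
    simp [magEnergy] at this
  have hneg' : IsVNegative Φ W (LinearMap.range T) := by
    refine ⟨?_, ?_⟩
    · rintro _ ⟨c, rfl⟩
      rw [hTa]
      exact hsum c
    · rintro _ ⟨c, rfl⟩ hne
      have hc : c ≠ 0 := fun h => hne (by rw [h, map_zero])
      rw [hTa]
      exact key c hc
  have hfr : Module.finrank ℂ (LinearMap.range T) = Fintype.card ι := by
    rw [LinearMap.finrank_range_of_inj hinj, Module.finrank_fintype_fun_eq_card]
  rw [← hfr]
  exact le_iSup₂ (f := fun (M : Submodule ℂ (ℝ × ℝ → ℂ))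
    (_ : FiniteDimensional ℂ M ∧ IsVNegative Φ W M) => (Module.finrank ℂ M : ℝ≥0∞))
    (LinearMap.range T) ⟨inferInstance, hneg'⟩

end Superposition

lemma log_sub_log_le_sum {T J : ℕ} (h : T ≤ J) :
    log (J + 1) - log (T + 1) ≤ ∑ j ∈ Finset.Ico T J, ((j : ℝ) + 1)⁻¹ := by
  induction J, h using Nat.le_induction with
  | base => simp
  | succ J h ih =>
    rw [Finset.sum_Ico_succ_top h]
    have h1 := log_le_sub_one_of_pos (show (0 : ℝ) < (J + 1 + 1) / (J + 1) by positivity)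
    rw [log_div (by positivity) (by positivity)] at h1
    have h2 : ((J : ℝ) + 1 + 1) / (J + 1) - 1 = ((J : ℝ) + 1)⁻¹ := by field_simp; ring
    push_cast
    linarith

/-- A step function below a potential with critical logarithmic decay. -/
noncomputable def minorant (lam ε : ℝ) (T : ℕ) (j : ℤ) : ℝ :=
  if T ≤ j then lam * ((1 - ε) / (j + 1)) else 0

lemma minorant_natCast (lam ε : ℝ) {T j : ℕ} (h : T ≤ j) :
    minorant lam ε T j = lam * ((1 - ε) / (j + 1)) := by
  rw [minorant, if_pos (by exact_mod_cast h)]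
  simp

lemma abs_minorant_le {lam ε : ℝ} (hl : 0 ≤ lam) (hε : 0 ≤ ε) (hε1 : ε ≤ 1) (T : ℕ) (j : ℤ) :
    |minorant lam ε T j| ≤ lam := by
  unfold minorant
  split_ifs with h
  · have h1 : (0 : ℝ) ≤ j := by
      have : (0 : ℤ) ≤ j := by omega
      exact_mod_cast this
    have h2 : (1 - ε) / ((j : ℝ) + 1) ≤ 1 := by
      rw [div_le_one (by linarith)]
      linarith
    have h3 : 0 ≤ (1 - ε) / ((j : ℝ) + 1) := div_nonneg (by linarith) (by linarith)
    rw [abs_of_nonneg (mul_nonneg hl h3)]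
    exact mul_le_of_le_one_right hl h2
  · simpa using hl

lemma minorant_le {V : ℝ × ℝ → ℝ} {lam ε : ℝ} (hl : 0 ≤ lam) (hε1 : ε ≤ 1) {T : ℕ} (hT : 0 < T)
    (hV : ∀ x : ℝ × ℝ, (T : ℝ) ≤ log (√(sqnorm x)) →
      1 - ε < sqnorm x * log (√(sqnorm x)) * V x) {x : ℝ × ℝ} {j : ℕ} (hj : T ≤ j)
    (hx : ⌊log (√(sqnorm x))⌋ = (j : ℤ)) : minorant lam ε T j / sqnorm x ≤ lam * V x := by
  have hV' := hV x
  have hx0 : x ≠ 0 := by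
    rintro rfl
    have : sqnorm 0 = 0 := by simp [sqnorm]
    rw [this, sqrt_zero, log_zero, Int.floor_zero] at hx
    omega
  have hs := sqnorm_pos_of_ne hx0
  obtain ⟨h1, h2⟩ := Int.floor_eq_iff.1 hx
  push_cast at h1 h2
  set t := log (√(sqnorm x))
  have hTj : (T : ℝ) ≤ j := by exact_mod_cast hj
  have hT0 : (0 : ℝ) < T := by exact_mod_cast hT
  have h3 := hV' (by linarith)
  have h4 : 0 ≤ V x := by
    by_contra h
    have : sqnorm x * t * V x ≤ 0 :=
      mul_nonpos_of_nonneg_of_nonpos (mul_nonneg hs.le (by linarith)) (by linarith)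
    linarith
  rw [minorant_natCast lam ε hj, mul_div_assoc]
  refine mul_le_mul_of_nonneg_left ?_ hl
  rw [div_div, div_le_iff₀ (mul_pos (by linarith) hs)]
  have := mul_le_mul_of_nonneg_left h2.le (mul_nonneg h4 hs.le)
  nlinarith

/-- The number of trial functions supported in a unit interval. -/
noncomputable def cellCount (η e : ℝ) : ℕ := ⌊√e / (π * η)⌋₊

lemma mul_cellCount_le {η : ℝ} (hη : 0 < η) (e : ℝ) : π * η * cellCount η e ≤ √e := by
  have := Nat.floor_le (a := √e / (π * η)) (by positivity)
  rw [le_div_iff₀ (by positivity)] at this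
  rw [cellCount]
  linarith

section Cells

variable {g : ℝ → ℝ} {ρ : ℝ} {m i j : ℕ} {t : ℝ}

lemma cell_eventually_zero (hρ : 0 < ρ) (hg : ∀ t, t ≤ ρ ∨ 1 - ρ ≤ t → g t = 0)
    (h : m * (t - (j + i / m)) ∉ Ioo (0 : ℝ) 1) : ∀ᶠ s in 𝓝 t, g (m * (s - (j + i / m))) = 0 := by
  have hc : Continuous fun s : ℝ => m * (s - (j + i / m)) := by fun_prop
  rw [mem_Ioo, not_and_or, not_lt, not_lt] at h
  rcases h with h | h
  · filter_upwards [hc.continuousAt.eventually_lt_const (h.trans_lt hρ)] with s hs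
    exact hg _ (Or.inl hs.le)
  · filter_upwards [hc.continuousAt.eventually_const_lt (show 1 - ρ < _ by linarith)] with s hs
    exact hg _ (Or.inr hs.le)

lemma mem_cell (hi : i < m) (h : m * (t - (j + i / m)) ∈ Ioo (0 : ℝ) 1) :
    t ∈ Ioo (j : ℝ) (j + 1) ∧ ⌊m * (t - j)⌋ = i := by
  have hm : (0 : ℝ) < m := by exact_mod_cast (Nat.zero_le i).trans_lt hi
  have e : m * (t - (j + i / m)) = m * (t - j) - i := by field_simp; ring
  rw [e] at h
  have hi' : (i : ℝ) + 1 ≤ m := by exact_mod_cast hi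
  have hi0 : (0 : ℝ) ≤ i := Nat.cast_nonneg i
  refine ⟨⟨?_, ?_⟩, Int.floor_eq_iff.2 ⟨?_, ?_⟩⟩
  · have : 0 < m * (t - j) := by linarith [h.1]
    linarith [pos_of_mul_pos_right this hm.le]
  · have : m * (t - j) < m * 1 := by linarith [h.2]
    linarith [lt_of_mul_lt_mul_left this hm.le]
  · push_cast
    linarith [h.1]
  · push_cast
    linarith [h.2]

end Cells

lemma sum_cellCount_le_negEigCount {Φ : ℝ} {V : ℝ × ℝ → ℝ} (hVm : Measurable V) {B : ℝ}
    (hVb : ∀ᵐ x : ℝ × ℝ, |V x| ≤ B) {ε η lam : ℝ} (hε : 0 ≤ ε) (hε1 : ε ≤ 1) (hη : 1 < η)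
    (hl : 0 ≤ lam) {T : ℕ} (hT : 0 < T)
    (hV : ∀ x : ℝ × ℝ, (T : ℝ) ≤ log (√(sqnorm x)) → 1 - ε < sqnorm x * log (√(sqnorm x)) * V x)
    (J n : ℕ) :
    ((∑ j ∈ Finset.Ico T J, ∑ k ∈ momenta Φ n,
      cellCount η (minorant lam ε T j - ((k : ℝ) - Φ) ^ 2) : ℕ) : ℝ≥0∞) ≤
      negEigCount Φ (fun x => lam * V x) := by
  classical
  obtain ⟨ρ, hρ, g, hg, hg0, hgneg⟩ := exists_trial hη
  set m : ℕ → ℤ → ℕ := fun j k => cellCount η (minorant lam ε T j - ((k : ℝ) - Φ) ^ 2) with hm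
  set A : Finset (Σ _ : ℕ, Σ _ : ℤ, ℕ) := (Finset.Ico T J).sigma fun j =>
    (momenta Φ n).sigma fun k => Finset.range (m j k) with hA
  have hcard : Fintype.card A = ∑ j ∈ Finset.Ico T J, ∑ k ∈ momenta Φ n, m j k := by
    rw [Fintype.card_coe, hA, Finset.card_sigma]
    simp only [Finset.card_sigma, Finset.card_range]
  have hmem : ∀ a : A, T ≤ a.1.1 ∧ a.1.2.2 < m a.1.1 a.1.2.1 := by
    rintro ⟨⟨j, k, i⟩, ha⟩
    simp only [hA, Finset.mem_sigma, Finset.mem_Ico, Finset.mem_range] at ha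
    exact ⟨ha.1.1, ha.2.2⟩
  set G : A → ℝ → ℝ := fun a t =>
    g (m a.1.1 a.1.2.1 * (t - (a.1.1 + a.1.2.2 / m a.1.1 a.1.2.1))) with hG
  have hz : ∀ (a : A) (t : ℝ), m a.1.1 a.1.2.1 * (t - (a.1.1 + a.1.2.2 / m a.1.1 a.1.2.1)) ∉
      Ioo (0 : ℝ) 1 → G a t = 0 ∧ deriv (G a) t = 0 := by
    intro a t h
    have hev := cell_eventually_zero hρ hg0 h
    refine ⟨hev.self_of_nhds, ?_⟩
    have : G a =ᶠ[𝓝 t] fun _ => 0 := hev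
    rw [this.deriv_eq, deriv_const]
  have hsame : ∀ (a a' : A) (t : ℝ), a ≠ a' → a.1.2.1 = a'.1.2.1 →
      m a.1.1 a.1.2.1 * (t - (a.1.1 + a.1.2.2 / m a.1.1 a.1.2.1)) ∈ Ioo (0 : ℝ) 1 →
      m a'.1.1 a'.1.2.1 * (t - (a'.1.1 + a'.1.2.2 / m a'.1.1 a'.1.2.1)) ∉ Ioo (0 : ℝ) 1 := by
    intro a a' t hne hk h h'
    obtain ⟨h1, h2⟩ := mem_cell (hmem a).2 h
    obtain ⟨h1', h2'⟩ := mem_cell (hmem a').2 h'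
    obtain ⟨⟨j, k, i⟩, ha⟩ := a
    obtain ⟨⟨j', k', i'⟩, ha'⟩ := a'
    simp only at hk h1 h2 h1' h2'
    subst hk
    have hj : (j : ℤ) = j' := by
      rw [← Int.floor_eq_iff.2 (show ((j : ℤ) : ℝ) ≤ t ∧ t < ((j : ℤ) : ℝ) + 1 from
        ⟨h1.1.le, h1.2⟩), Int.floor_eq_iff.2 (show ((j' : ℤ) : ℝ) ≤ t ∧ t < ((j' : ℤ) : ℝ) + 1 from
        ⟨h1'.1.le, h1'.2⟩)]
    have hj' : j = j' := by exact_mod_cast hj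
    subst hj'
    rw [h2] at h2'
    have : i = i' := by exact_mod_cast h2'
    subst this
    exact hne rfl
  rw [← hcard]
  refine card_le_negEigCount (E := minorant lam ε T) (abs_minorant_le hl hε hε1 T)
    (hVm.const_mul lam) (B := lam * B) ?_ (k := fun a : A => a.1.2.1) (j := fun a : A => (a.1.1 : ℤ))
    (fun x a hx => minorant_le hl hε1 hT hV (hmem a).1 hx) (G := G) ?_ ?_ ?_ ?_ ?_ ?_
  · filter_upwards [hVb] with x hx
    rw [abs_mul, abs_of_nonneg hl]
    exact mul_le_mul_of_nonneg_left hx hl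
  · intro a
    exact hg.comp (by fun_prop)
  · intro a t ht
    refine (hz a t fun h => ht ?_).1
    exact_mod_cast (mem_cell (hmem a).2 h).1
  · intro a a' hne hk t
    by_cases h : m a.1.1 a.1.2.1 * (t - (a.1.1 + a.1.2.2 / m a.1.1 a.1.2.1)) ∈ Ioo (0 : ℝ) 1
    · rw [(hz a' t (hsame a a' t hne hk h)).1, mul_zero]
    · rw [(hz a t h).1, zero_mul]
  · intro a a' hne hk t
    by_cases h : m a.1.1 a.1.2.1 * (t - (a.1.1 + a.1.2.2 / m a.1.1 a.1.2.1)) ∈ Ioo (0 : ℝ) 1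
    · rw [(hz a' t (hsame a a' t hne hk h)).2, mul_zero]
    · rw [(hz a t h).2, zero_mul]
  · intro a
    have hmpos : 0 < m a.1.1 a.1.2.1 := (Nat.zero_le _).trans_lt (hmem a).2
    have hκ := mul_cellCount_le (zero_lt_one.trans hη)
      (minorant lam ε T a.1.1 - ((a.1.2.1 : ℝ) - Φ) ^ 2)
    have hpos : 0 < √(minorant lam ε T a.1.1 - ((a.1.2.1 : ℝ) - Φ) ^ 2) := by
      have : (0 : ℝ) < m a.1.1 a.1.2.1 := by exact_mod_cast hmpos
      have hη0 : 0 < η := zero_lt_one.trans hη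
      exact (show 0 < π * η * m a.1.1 a.1.2.1 by positivity).trans_le hκ
    have := hgneg (m a.1.1 a.1.2.1) (a.1.1 + a.1.2.2 / m a.1.1 a.1.2.1) _ hmpos hκ
    rw [sq_sqrt (sqrt_pos.1 hpos).le] at this
    exact this
  · intro a
    exact Int.natCast_nonneg _

/-- Asymptotic lower bound for the number of negative eigenvalues. -/
lemma eventually_le_negEigCount (Φ : ℝ) {V : ℝ × ℝ → ℝ}
    (hVm : Measurable V) (hVb : ∃ B : ℝ, ∀ᵐ x : ℝ × ℝ, |V x| ≤ B)
    (hV : Tendsto (fun x : ℝ × ℝ => sqnorm x * log (√(sqnorm x)) * V x)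
      (cocompact (ℝ × ℝ)) (𝓝 1)) {δ : ℝ} (hδ : 0 < δ) :
    ∀ᶠ lam : ℝ in atTop, ENNReal.ofReal ((1 / 2 - δ) * (lam * log lam)) ≤
      negEigCount Φ (fun x => lam * V x) := by
  set ε := min (δ / 4) (1 / 4) with hε
  have hε0 : 0 < ε := lt_min (by linarith) (by norm_num)
  have hε1 : ε ≤ δ / 4 := min_le_left _ _
  have hε2 : ε ≤ 1 / 4 := min_le_right _ _
  obtain ⟨B, hB⟩ := hVb
  obtain ⟨T, hT, hVT⟩ := exists_asymp_radius hV hε0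
  set η := (1 - ε)⁻¹ with hη
  have hη1 : 1 < η := (one_lt_inv₀ (by linarith)).2 (by linarith)
  obtain ⟨C, hC, hlat⟩ := lattice_lower hε0 hη1.le
  have hη2 : 1 / (2 * η) = (1 - ε) / 2 := by
    rw [hη]
    have : (1 - ε) ≠ 0 := by linarith
    field_simp
  rw [hη2] at hlat
  set c := ((1 - ε) / 2 - ε) * (1 - ε) with hc
  have hc0 : 0 ≤ c := mul_nonneg (by linarith) (by linarith)
  have hc1 : 1 / 2 - δ / 2 ≤ c := by nlinarith
  set D := c * log (T + 1) + 2 * C with hD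
  filter_upwards [eventually_ge_atTop 1, tendsto_log_atTop.eventually_ge_atTop (D / (δ / 2))]
    with lam h1 h2
  have hl0 : 0 < lam := by linarith
  obtain ⟨n, hn⟩ := exists_nat_ge √lam
  refine le_trans ?_ (sum_cellCount_le_negEigCount hVm hB hε0.le (by linarith) hη1 hl0.le hT
    (fun x hx => (hVT x hx).1) (⌈lam⌉₊ + T) n)
  rw [← ENNReal.ofReal_natCast]
  refine ENNReal.ofReal_le_ofReal ?_
  push_cast
  have hsum : ∑ j ∈ Finset.Ico T (⌈lam⌉₊ + T), (((1 - ε) / 2 - ε) * minorant lam ε T j - C) ≤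
      ∑ j ∈ Finset.Ico T (⌈lam⌉₊ + T), ∑ k ∈ momenta Φ n,
        (cellCount η (minorant lam ε T j - ((k : ℝ) - Φ) ^ 2) : ℝ) := by
    refine Finset.sum_le_sum fun j hj => hlat Φ _ n ?_ ?_
    · rw [minorant_natCast lam ε (Finset.mem_Ico.1 hj).1]
      exact mul_nonneg hl0.le (div_nonneg (by linarith) (by positivity))
    · refine le_trans (sqrt_le_sqrt ?_) hn
      exact (le_abs_self _).trans (abs_minorant_le hl0.le hε0.le (by linarith) T j)
  refine le_trans ?_ hsum
  have hrew : ∑ j ∈ Finset.Ico T (⌈lam⌉₊ + T), (((1 - ε) / 2 - ε) * minorant lam ε T j - C) =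
      c * lam * ∑ j ∈ Finset.Ico T (⌈lam⌉₊ + T), ((j : ℝ) + 1)⁻¹ - ⌈lam⌉₊ * C := by
    rw [Finset.sum_sub_distrib, Finset.sum_const, Nat.card_Ico, nsmul_eq_mul, Nat.add_sub_cancel,
      Finset.mul_sum]
    congr 1
    refine Finset.sum_congr rfl fun j hj => ?_
    rw [minorant_natCast lam ε (Finset.mem_Ico.1 hj).1, hc]
    ring
  rw [hrew]
  have hlog : log lam - log (T + 1) ≤ ∑ j ∈ Finset.Ico T (⌈lam⌉₊ + T), ((j : ℝ) + 1)⁻¹ := by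
    refine le_trans ?_ (log_sub_log_le_sum (Nat.le_add_left T _))
    refine sub_le_sub_right (log_le_log hl0 ?_) _
    push_cast
    linarith [Nat.le_ceil lam, (Nat.cast_nonneg T : (0 : ℝ) ≤ T)]
  have hceil : (⌈lam⌉₊ : ℝ) ≤ 2 * lam := by linarith [Nat.ceil_lt_add_one hl0.le]
  have h3 := mul_le_mul_of_nonneg_left hlog (mul_nonneg hc0 hl0.le)
  have h4 := mul_le_mul_of_nonneg_right hceil hC
  rw [div_le_iff₀ (by linarith)] at h2
  have h5 : D * lam ≤ log lam * (δ / 2) * lam := mul_le_mul_of_nonneg_right h2 hl0.le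
  have h6 : 0 ≤ lam * log lam := mul_nonneg hl0.le (log_nonneg h1)
  have h7 := mul_le_mul_of_nonneg_right hc1 h6
  rw [hD] at h5
  linarith

end StrongCoupling

theorem strong_coupling_asymptotics_AB_borderline
    (Φ : ℝ) (hΦ : ∀ k : ℤ, Φ ≠ k)
    (V : ℝ × ℝ → ℝ) (hVmeas : Measurable V)
    (hVbdd : ∃ B : ℝ, ∀ᵐ x : ℝ × ℝ, |V x| ≤ B)
    (hVasymp : Filter.Tendsto
      (fun x : ℝ × ℝ => sqnorm x * Real.log (Real.sqrt (sqnorm x)) * V x)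
      (Filter.cocompact (ℝ × ℝ)) (nhds 1)) :
    Filter.Tendsto
      (fun lam : ℝ =>
        ENNReal.ofReal ((lam * Real.log lam)⁻¹) * negEigCount Φ (fun x => lam * V x))
      Filter.atTop (nhds (ENNReal.ofReal (1 / 2))) := by
  have key : ∀ c : ℝ, ∀ lam : ℝ, 0 < lam * Real.log lam →
      ENNReal.ofReal ((lam * Real.log lam)⁻¹) * ENNReal.ofReal (c * (lam * Real.log lam)) =
        ENNReal.ofReal c := by
    intro c lam hlam
    rw [← ENNReal.ofReal_mul (inv_nonneg.2 hlam.le)]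
    congr 1
    rw [mul_comm c, inv_mul_cancel_left₀ hlam.ne']
  have hpos : ∀ᶠ lam : ℝ in Filter.atTop, 0 < lam * Real.log lam := by
    filter_upwards [Filter.eventually_gt_atTop 1] with lam hlam
    exact mul_pos (by linarith) (Real.log_pos hlam)
  have hcont : ∀ s : ℝ, Filter.Tendsto (fun δ : ℝ => ENNReal.ofReal (1 / 2 + s * δ))
      (nhdsWithin 0 (Set.Ioi 0)) (nhds (ENNReal.ofReal (1 / 2))) := by
    intro s
    have h : Continuous fun δ : ℝ => ENNReal.ofReal (1 / 2 + s * δ) :=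
      ENNReal.continuous_ofReal.comp (by fun_prop)
    simpa using (h.tendsto 0).mono_left nhdsWithin_le_nhds
  refine tendsto_order.2 ⟨fun a ha => ?_, fun a ha => ?_⟩
  · obtain ⟨δ, h1, h2⟩ :=
      (((hcont (-1)).eventually (lt_mem_nhds ha)).and self_mem_nhdsWithin).exists
    filter_upwards [hpos, eventually_le_negEigCount Φ hVmeas hVbdd hVasymp h2] with lam h3 h4
    refine h1.trans_le ?_
    rw [← key (1 / 2 + -1 * δ) lam h3]
    gcongr
    rwa [neg_one_mul, ← sub_eq_add_neg]
  · obtain ⟨δ, h1, h2⟩ :=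
      (((hcont 1).eventually (gt_mem_nhds ha)).and self_mem_nhdsWithin).exists
    filter_upwards [hpos, eventually_negEigCount_le hΦ hVmeas hVbdd hVasymp h2] with lam h3 h4
    refine lt_of_le_of_lt ?_ h1
    rw [← key (1 / 2 + 1 * δ) lam h3]
    gcongr
    rwa [one_mul]
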